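/- arXiv:math/9905064 — 2 statements merged into one kernel-verified Lean document; each statement's English description precedes it below -/
import Mathlib

section
/- For vertex operator algebras V_1,…,V_n, the linear map F sending [v_1]⊗···⊗[v_n] to [v_1⊗···⊗v_n] is an isomorphism of associative algebras from A(V_1)⊗···⊗A(V_n) onto A(V_1⊗···⊗V_n). -/
/-!
Common framework: vertex operator algebras over ℂ encoded via their modes,
weak/admissible/ordinary modules, twisted modules, Zhu's algebra data,
and the free bosonic (Heisenberg) vertex operator algebra `𝓗 = M(1)` of rank `ℓ`
together with its `θ`-fixed subalgebra `𝓗⁺`.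
-/

open scoped BigOperators DirectSum TensorProduct

noncomputable section

/-- Generalized binomial coefficient `(q choose n)` for `q : ℚ`. -/
def qchoose (q : ℚ) : ℕ → ℚ
  | 0 => 1
  | n + 1 => qchoose q n * (q - n) / (n + 1)

/-- Generalized binomial coefficient of an integer, as a complex number. -/
def zchoose (m : ℤ) (n : ℕ) : ℂ := ((qchoose (m : ℚ) n : ℚ) : ℂ)

/-- A vertex operator algebra over `ℂ`, encoded through its modes:
`Y u n : Module.End ℂ V` is the `n`-th mode `u_n` of the vertex operator `Y(u,z)`.
The axioms are: truncation, the vacuum and creation axioms, the (component form of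
the) Jacobi/Borcherds identity, a lower-truncated `ℤ`-grading by `L(0)`-eigenvalues
with finite dimensional homogeneous pieces compatible with the modes, the Virasoro
relations for the conformal vector and the `L(-1)`-derivative (translation) axiom. -/
structure VOA (V : Type) [AddCommGroup V] [Module ℂ V] : Type where
  Y : V →ₗ[ℂ] ℤ → Module.End ℂ V
  one : V
  omega : V
  wt : ℤ → Submodule ℂ V
  centralCharge : ℂ
  internal : DirectSum.IsInternal wt
  one_wt : one ∈ wt 0
  omega_wt : omega ∈ wt 2
  one_ne_zero : one ≠ 0
  fdim : ∀ n : ℤ, FiniteDimensional ℂ (wt n)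
  bounded_below : ∃ N : ℤ, ∀ n : ℤ, n < N → wt n = ⊥
  trunc : ∀ u v : V, ∃ N : ℤ, ∀ n : ℤ, N ≤ n → Y u n v = 0
  vacuum_act : ∀ n : ℤ, Y one n = if n = -1 then (1 : Module.End ℂ V) else 0
  create : ∀ u : V, Y u (-1) one = u
  create_ge : ∀ (u : V) (n : ℤ), 0 ≤ n → Y u n one = 0
  mode_wt : ∀ (k : ℤ) (u : V), u ∈ wt k → ∀ (m n : ℤ) (v : V), v ∈ wt m →
    Y u n v ∈ wt (m + k - n - 1)
  L0_diag : ∀ (n : ℤ) (v : V), v ∈ wt n → Y omega 1 v = (n : ℂ) • v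
  translation : ∀ (u : V) (n : ℤ), Y (Y omega 0 u) n = (-(n : ℂ)) • Y u (n - 1)
  virasoro : ∀ m n : ℤ,
    Y omega (m + 1) * Y omega (n + 1) - Y omega (n + 1) * Y omega (m + 1)
      = ((m : ℂ) - (n : ℂ)) • Y omega (m + n + 1)
        + (if m + n = 0 then (((m ^ 3 - m : ℤ) : ℂ) / 12) * centralCharge else 0)
            • (1 : Module.End ℂ V)
  borcherds : ∀ (u v w : V) (p m n : ℤ),
    ∑ᶠ i : ℕ, zchoose m i • Y (Y u (p + i) v) (m + n - i) w
      = ∑ᶠ i : ℕ, ((-1 : ℂ) ^ i * zchoose p i) •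
          (Y u (m + p - i) (Y v (n + i) w)
            - ((-1 : ℂ) ^ p) • Y v (n + p - i) (Y u (m + i) w))

variable {V : Type} [AddCommGroup V] [Module ℂ V]

/-- Simplicity of a vertex operator algebra: the only subspaces invariant under
all modes are `0` and the whole space. -/
def VOA.Simple (A : VOA V) : Prop :=
  ∀ U : Submodule ℂ V, (∀ (u : V) (n : ℤ) (v : V), v ∈ U → A.Y u n v ∈ U) → U = ⊥ ∨ U = ⊤

/-- The decomposition of a vertex operator algebra into its homogeneous pieces. -/
noncomputable def VOA.decompose (A : VOA V) : V ≃ₗ[ℂ] ⨁ n : ℤ, A.wt n :=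
  (LinearEquiv.ofBijective (DirectSum.coeLinearMap A.wt) A.internal).symm

/-- The homogeneous component of weight `n` of a vector. -/
noncomputable def VOA.hcomp (A : VOA V) (n : ℤ) (u : V) : V := (A.decompose u n : V)

/-- Zhu's product `u * v` for `u` (treated as) homogeneous of weight `k`:
`u*v = ∑_{i≥0} (k choose i) u_{i-1} v`. -/
noncomputable def VOA.mulAux (A : VOA V) (k : ℤ) (u v : V) : V :=
  ∑ᶠ i : ℕ, zchoose k i • A.Y u ((i : ℤ) - 1) v

/-- Zhu's circle product `u ∘ v` for `u` (treated as) homogeneous of weight `k`: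
`u∘v = ∑_{i≥0} (k choose i) u_{i-2} v`. -/
noncomputable def VOA.circAux (A : VOA V) (k : ℤ) (u v : V) : V :=
  ∑ᶠ i : ℕ, zchoose k i • A.Y u ((i : ℤ) - 2) v

/-- Zhu's product `u * v`, extended bilinearly via homogeneous components of `u`. -/
noncomputable def VOA.star (A : VOA V) (u v : V) : V :=
  ∑ᶠ k : ℤ, A.mulAux k (A.hcomp k u) v

/-- The subspace `O(V)` spanned by all circle products `u ∘ v` with `u` homogeneous;
Zhu's algebra is `A(V) = V/O(V)` with product induced by `VOA.star`. -/
def VOA.Osub (A : VOA V) : Submodule ℂ V :=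
  Submodule.span ℂ {w | ∃ (k : ℤ) (u v : V), u ∈ A.wt k ∧ w = A.circAux k u v}

/-- A weak module for a vertex operator algebra, given by modes satisfying
truncation, the vacuum axiom and the Borcherds identity. -/
structure WkMod (A : VOA V) (M : Type) [AddCommGroup M] [Module ℂ M] : Type where
  act : V →ₗ[ℂ] ℤ → Module.End ℂ M
  trunc : ∀ (u : V) (w : M), ∃ N : ℤ, ∀ n : ℤ, N ≤ n → act u n w = 0
  vacuum_act : ∀ n : ℤ, act A.one n = if n = -1 then (1 : Module.End ℂ M) else 0
  borcherds : ∀ (u v : V) (w : M) (p m n : ℤ),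
    ∑ᶠ i : ℕ, zchoose m i • act (A.Y u (p + i) v) (m + n - i) w
      = ∑ᶠ i : ℕ, ((-1 : ℂ) ^ i * zchoose p i) •
          (act u (m + p - i) (act v (n + i) w)
            - ((-1 : ℂ) ^ p) • act v (n + p - i) (act u (m + i) w))

/-- An admissible (`ℕ`-gradable) module for a vertex operator algebra:
a weak module with an `ℕ`-grading with nonzero top level, compatible with weights. -/
structure AdmMod (A : VOA V) (M : Type) [AddCommGroup M] [Module ℂ M]
    extends WkMod A M : Type where
  gr : ℕ → Submodule ℂ M
  grInternal : DirectSum.IsInternal gr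
  top_ne_bot : gr 0 ≠ ⊥
  gr_mode : ∀ (k : ℤ) (u : V), u ∈ A.wt k → ∀ (m : ℤ) (n : ℕ) (w : M), w ∈ gr n →
    act u m w ∈
      if 0 ≤ (n : ℤ) + k - m - 1 then gr ((n : ℤ) + k - m - 1).toNat else ⊥

/-- An ordinary module for a vertex operator algebra: a weak module on which `L(0)`
acts semisimply with finite dimensional eigenspaces whose weights are truncated from
below in each coset `λ + ℤ`. -/
structure OrdMod (A : VOA V) (M : Type) [AddCommGroup M] [Module ℂ M]
    extends WkMod A M : Type where
  wtm : ℂ → Submodule ℂ M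
  indep : iSupIndep wtm
  spans : ⨆ c : ℂ, wtm c = ⊤
  L0_diag : ∀ (c : ℂ) (w : M), w ∈ wtm c → act A.omega 1 w = c • w
  fdim : ∀ c : ℂ, FiniteDimensional ℂ (wtm c)
  bounded_below : ∀ c : ℂ, ∃ N : ℤ, ∀ m : ℤ, m < N → wtm (c + m) = ⊥

/-- Irreducibility of a weak module. -/
def WkMod.Irreducible {A : VOA V} {M : Type} [AddCommGroup M] [Module ℂ M]
    (P : WkMod A M) : Prop :=
  (∃ w : M, w ≠ 0) ∧
    ∀ U : Submodule ℂ M, (∀ (u : V) (n : ℤ) (w : M), w ∈ U → P.act u n w ∈ U) →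
      U = ⊥ ∨ U = ⊤

/-- Isomorphism of two weak modules over the same vertex operator algebra. -/
def ModIso (A : VOA V) {M N : Type} [AddCommGroup M] [Module ℂ M]
    [AddCommGroup N] [Module ℂ N] (P : WkMod A M) (Q : WkMod A N) : Prop :=
  ∃ f : M ≃ₗ[ℂ] N, ∀ (u : V) (n : ℤ) (w : M), f (P.act u n w) = Q.act u n (f w)

/-- The action of the zero-mode `o(u) = u_{wt u - 1}` (extended linearly from
homogeneous vectors) on a weak module; it preserves the top level of an
admissible module. -/
noncomputable def WkMod.oAct {A : VOA V} {M : Type} [AddCommGroup M] [Module ℂ M]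
    (Q : WkMod A M) (u : V) (w : M) : M :=
  ∑ᶠ k : ℤ, Q.act (A.hcomp k u) (k - 1) w

/-- Action of a word of creation operators `h_{a_1}(-n_1) ⋯ h_{a_k}(-n_k)`. -/
def wordAct {ℓ : ℕ} {M : Type} (f : Fin ℓ → ℤ → M → M) : List (Fin ℓ × ℕ+) → M → M
  | [], w => w
  | (a, n) :: L, w => f a (-((n : ℕ) : ℤ)) (wordAct f L w)

/-- Action of a word of twisted creation operators
`h_{a_1}(-n_1+1/2) ⋯ h_{a_k}(-n_k+1/2)` (indices doubled). -/
def twWordAct {ℓ : ℕ} {M : Type} (f : Fin ℓ → ℤ → M → M) : List (Fin ℓ × ℕ+) → M → M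
  | [], w => w
  | (a, n) :: L, w => f a (-(2 * ((n : ℕ) : ℤ) - 1)) (twWordAct f L w)

/-- `A` is the rank `ℓ` free bosonic (Heisenberg) vertex operator algebra
`𝓗 = M(1)`, with generators `hgen a = h_a(-1)𝟏` for an orthonormal basis
`h_1, …, h_ℓ` of `𝔥`: the generators have weight one, their modes satisfy the
Heisenberg commutation relations `[h_a(m), h_b(n)] = m δ_{ab} δ_{m+n,0}`, the
conformal vector is `ω = (1/2) ∑_a h_a(-1)²𝟏`, and `V` is spanned by the vectors
`h_{a_1}(-n_1) ⋯ h_{a_k}(-n_k)𝟏`. -/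
structure IsHeisenberg {ℓ : ℕ} (A : VOA V) (hgen : Fin ℓ → V) : Prop where
  wt_one : ∀ a, hgen a ∈ A.wt 1
  heis_comm : ∀ (a b : Fin ℓ) (m n : ℤ),
    A.Y (hgen a) m * A.Y (hgen b) n - A.Y (hgen b) n * A.Y (hgen a) m
      = (if a = b ∧ m + n = 0 then (m : ℂ) else 0) • (1 : Module.End ℂ V)
  omega_eq : A.omega
      = (1 / 2 : ℂ) • ∑ a : Fin ℓ, A.Y (hgen a) (-1) (A.Y (hgen a) (-1) A.one)
  span_words : Submodule.span ℂ
      {v : V | ∃ L : List (Fin ℓ × ℕ+),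
        v = wordAct (fun a k w => A.Y (hgen a) k w) L A.one} = ⊤

/-- `θ` is the automorphism of the free bosonic vertex operator algebra induced
by `-1` on `𝔥`. -/
structure IsThetaAut {ℓ : ℕ} (A : VOA V) (hgen : Fin ℓ → V) (θ : V ≃ₗ[ℂ] V) : Prop where
  map_one : θ A.one = A.one
  map_omega : θ A.omega = A.omega
  map_Y : ∀ (u : V) (n : ℤ) (v : V), θ (A.Y u n v) = A.Y (θ u) n (θ v)
  map_gen : ∀ a, θ (hgen a) = -hgen a
  map_wt : ∀ (k : ℤ) (v : V), v ∈ A.wt k → θ v ∈ A.wt k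

/-- `B` (with underlying space `W`, embedded in `V` by `ι`) is the fixed point
vertex operator subalgebra `V^θ` of the involution `θ`. -/
structure IsFixedSubVOA {W : Type} [AddCommGroup W] [Module ℂ W]
    (A : VOA V) (θ : V ≃ₗ[ℂ] V) (B : VOA W) (ι : W →ₗ[ℂ] V) : Prop where
  inj : Function.Injective ι
  range_eq : LinearMap.range ι
      = Module.End.eigenspace (θ.toLinearMap : Module.End ℂ V) 1
  map_one : ι B.one = A.one
  map_omega : ι B.omega = A.omega
  map_Y : ∀ (u : W) (n : ℤ) (v : W), ι (B.Y u n v) = A.Y (ι u) n (ι v)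
  map_wt : ∀ (k : ℤ) (w : W), w ∈ B.wt k ↔ ι w ∈ A.wt k

/-- `P` is (isomorphic to) the Fock module `M(1,λ)` over the rank `ℓ` Heisenberg
vertex operator algebra: it has a nonzero vector `v₀` with `h_a(n)v₀ = 0` for
`n ≥ 1`, `h_a(0)v₀ = λ_a v₀`, which generates `M` under the creation operators. -/
def IsFockModule {ℓ : ℕ} {M : Type} [AddCommGroup M] [Module ℂ M]
    (A : VOA V) (hgen : Fin ℓ → V) (P : WkMod A M) (lam : Fin ℓ → ℂ) : Prop :=
  ∃ v0 : M, v0 ≠ 0 ∧ (∀ (a : Fin ℓ) (n : ℤ), 1 ≤ n → P.act (hgen a) n v0 = 0) ∧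
    (∀ a : Fin ℓ, P.act (hgen a) 0 v0 = lam a • v0) ∧
    Submodule.span ℂ {w : M | ∃ L : List (Fin ℓ × ℕ+),
      w = wordAct (fun a k x => P.act (hgen a) k x) L v0} = ⊤

/-- A weak `θ`-twisted module (for an involution `θ`): the modes are indexed by
`(1/2)ℤ`, encoded here by doubling (so `act u k` is the mode `u_{k/2}`); on the
eigenspace `θ = (-1)^r` only modes with `k ≡ r (mod 2)` act, and the component
form of the twisted Jacobi identity holds. -/
structure TwMod (A : VOA V) (θ : V ≃ₗ[ℂ] V) (M : Type) [AddCommGroup M]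
    [Module ℂ M] : Type where
  act : V →ₗ[ℂ] ℤ → Module.End ℂ M
  trunc : ∀ (u : V) (w : M), ∃ N : ℤ, ∀ n : ℤ, N ≤ n → act u n w = 0
  vacuum_act : ∀ n : ℤ, act A.one n = if n = -2 then (1 : Module.End ℂ M) else 0
  moding : ∀ (u : V) (r : ℤ), θ u = ((-1 : ℂ) ^ r) • u →
    ∀ k : ℤ, (k - r) % 2 ≠ 0 → act u k = 0
  borcherds : ∀ (u v : V) (r s : ℤ), θ u = ((-1 : ℂ) ^ r) • u →
    θ v = ((-1 : ℂ) ^ s) • v → ∀ (w : M) (p K N : ℤ),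
    ∑ᶠ i : ℕ, ((qchoose ((K : ℚ) / 2) i : ℚ) : ℂ) • act (A.Y u (p + i) v) (K + N - 2 * i) w
      = ∑ᶠ i : ℕ, ((-1 : ℂ) ^ i * zchoose p i) •
          (act u (K + 2 * p - 2 * i) (act v (N + 2 * i) w)
            - ((-1 : ℂ) ^ p) • act v (N + 2 * p - 2 * i) (act u (K + 2 * i) w))

/-- Irreducibility of a twisted module. -/
def TwMod.Irreducible {A : VOA V} {θ : V ≃ₗ[ℂ] V} {M : Type} [AddCommGroup M]
    [Module ℂ M] (T : TwMod A θ M) : Prop :=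
  (∃ w : M, w ≠ 0) ∧
    ∀ U : Submodule ℂ M, (∀ (u : V) (k : ℤ) (w : M), w ∈ U → T.act u k w ∈ U) →
      U = ⊥ ∨ U = ⊤

/-- `T` is (isomorphic to) the canonical irreducible `θ`-twisted module
`𝓗(θ) = S(𝔥 ⊗ t^{-1/2}ℂ[t^{-1/2}])` of the rank `ℓ` free bosonic vertex operator
algebra: it has a nonzero vector killed by all modes `h_a(k/2)`, `k ≥ 1`, which
generates it under the twisted creation operators. -/
def IsCanonicalTwMod {ℓ : ℕ} {M : Type} [AddCommGroup M] [Module ℂ M]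
    (A : VOA V) (hgen : Fin ℓ → V) {θ : V ≃ₗ[ℂ] V} (T : TwMod A θ M) : Prop :=
  ∃ v0 : M, v0 ≠ 0 ∧ (∀ (a : Fin ℓ) (k : ℤ), 1 ≤ k → T.act (hgen a) k v0 = 0) ∧
    Submodule.span ℂ {w : M | ∃ L : List (Fin ℓ × ℕ+),
      w = twWordAct (fun a k x => T.act (hgen a) k x) L v0} = ⊤

/-- `σ` is the canonical involution of the twisted module `𝓗(θ)` (acting by
`(-1)^k` on monomials of length `k`): it is an involution compatible with `θ`
through the twisted action and fixing the lowest weight vectors. -/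
def TwInvolution {ℓ : ℕ} {M : Type} [AddCommGroup M] [Module ℂ M]
    (A : VOA V) (hgen : Fin ℓ → V) {θ : V ≃ₗ[ℂ] V} (T : TwMod A θ M)
    (σ : M ≃ₗ[ℂ] M) : Prop :=
  (∀ w : M, σ (σ w) = w) ∧
  (∀ (u : V) (k : ℤ) (w : M), σ (T.act u k w) = T.act (θ u) k (σ w)) ∧
  (∀ v0 : M, (∀ (a : Fin ℓ) (k : ℤ), 1 ≤ k → T.act (hgen a) k v0 = 0) → σ v0 = v0)

/-- The weak `B = V^θ`-module `Q` "is" the eigenspace `V^{(ε)}` of `θ` on `V`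
(e.g. `𝓗⁺` itself for `ε = 1` and `𝓗⁻` for `ε = -1`), with action obtained by
restricting the vertex operators of `V`. -/
def IsEigenPartModule {W N : Type} [AddCommGroup W] [Module ℂ W]
    [AddCommGroup N] [Module ℂ N] (A : VOA V) (θ : V ≃ₗ[ℂ] V) {B : VOA W}
    (ι : W →ₗ[ℂ] V) (ε : ℂ) (Q : WkMod B N) : Prop :=
  ∃ j : N →ₗ[ℂ] V, Function.Injective j ∧
    LinearMap.range j = Module.End.eigenspace (θ.toLinearMap : Module.End ℂ V) ε ∧
    ∀ (u : W) (n : ℤ) (w : N), j (Q.act u n w) = A.Y (ι u) n (j w)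

/-- The weak `B = V^θ`-module `Q` "is" the eigenspace `𝓗(θ)^{(ε)}` of the
involution `σ` on the twisted module `𝓗(θ)`, with the restricted twisted action
(`u ∈ V^θ` acts by its integral modes). -/
def IsTwEigenPartModule {W MT N : Type} [AddCommGroup W] [Module ℂ W]
    [AddCommGroup MT] [Module ℂ MT] [AddCommGroup N] [Module ℂ N]
    (A : VOA V) {θ : V ≃ₗ[ℂ] V} {B : VOA W} (ι : W →ₗ[ℂ] V)
    (T : TwMod A θ MT) (σ : MT ≃ₗ[ℂ] MT) (ε : ℂ) (Q : WkMod B N) : Prop :=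
  ∃ j : N →ₗ[ℂ] MT, Function.Injective j ∧
    LinearMap.range j = Module.End.eigenspace (σ.toLinearMap : Module.End ℂ MT) ε ∧
    ∀ (u : W) (n : ℤ) (w : N), j (Q.act u n w) = T.act (ι u) (2 * n) (j w)

/-- The weak `B = 𝓗⁺`-module `Q` "is" the restriction to `𝓗⁺` of the Fock module
`M(1,λ)`. -/
def IsFockRestriction {ℓ : ℕ} {W N : Type} [AddCommGroup W] [Module ℂ W]
    [AddCommGroup N] [Module ℂ N] (A : VOA V) (hgen : Fin ℓ → V) {B : VOA W}
    (ι : W →ₗ[ℂ] V) (lam : Fin ℓ → ℂ) (Q : WkMod B N) : Prop :=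
  ∃ P : WkMod A N, IsFockModule A hgen P lam ∧
    ∀ (u : W) (n : ℤ), Q.act u n = P.act (ι u) n

/-- A realization of Zhu's algebra `A(V) = V/O(V)` of a vertex operator algebra
as an abstract associative `ℂ`-algebra `R`. -/
structure ZhuRealization (A : VOA V) (R : Type) [Ring R] [Algebra ℂ R] : Type where
  π : V →ₗ[ℂ] R
  surj : Function.Surjective π
  ker_eq : LinearMap.ker π = A.Osub
  map_star : ∀ u v : V, π (A.star u v) = π u * π v
  map_one : π A.one = 1

/-- The `R = A(V)`-module `M` "is" the top level `N(0)` of the admissible module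
`N`, where `[u] ∈ A(V)` acts on the top level by the zero-mode `o(u)`. -/
def IsTopLevelOf {R : Type} [Ring R] [Algebra ℂ R] {A : VOA V}
    (Z : ZhuRealization A R) {N : Type} [AddCommGroup N] [Module ℂ N]
    (Qa : AdmMod A N) (M : Type) [AddCommGroup M] [Module R M] : Prop :=
  ∃ f : M →+ N, Function.Injective f ∧ (∀ m : M, f m ∈ Qa.gr 0) ∧
    (∀ w ∈ Qa.gr 0, ∃ m : M, f m = w) ∧
    ∀ (u : V) (m : M), f (Z.π u • m) = Qa.toWkMod.oAct u (f m)

/-- Iterated Zhu product of a list of elements (an empty product is `[𝟏]`). -/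
noncomputable def starList (A : VOA V) : List V → V
  | [] => A.one
  | x :: L => A.star x (starList A L)

/-- The linear span of all Zhu-monomials in a set of generators; modulo `O(V)`
this is the subalgebra of `A(V)` generated by the images of the generators. -/
def genMonomials (A : VOA V) (gens : Set V) : Submodule ℂ V :=
  Submodule.span ℂ {w : V | ∃ L : List V, (∀ g ∈ L, g ∈ gens) ∧ w = starList A L}

/-- The subspace `𝓦^α ⊆ 𝓗` spanned by the monomials
`h_{a_1}(-n_1) ⋯ h_{a_k}(-n_k)𝟏` whose number of letters from `𝓗_c` is odd
exactly for `c ∈ α`; thus `wordSpanV A hgen ∅ = 𝓦 = 𝓗₁⁺ ⊗ ⋯ ⊗ 𝓗_ℓ⁺`. -/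
def wordSpanV {ℓ : ℕ} (A : VOA V) (hgen : Fin ℓ → V) (α : Finset (Fin ℓ)) :
    Submodule ℂ V :=
  Submodule.span ℂ {v : V | ∃ L : List (Fin ℓ × ℕ+),
    (∀ c : Fin ℓ, c ∈ α ↔ ¬ Even ((L.map Prod.fst).count c)) ∧
    v = wordAct (fun a k w => A.Y (hgen a) k w) L A.one}

/-- The element `S_{ab}(m,n) = h_a(-m)h_b(-n)𝟏` of `𝓗`. -/
def SV {ℓ : ℕ} (A : VOA V) (hgen : Fin ℓ → V) (a b : Fin ℓ) (m n : ℤ) : V :=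
  A.Y (hgen a) (-m) (A.Y (hgen b) (-n) A.one)

/-- The element `ω_a = (1/2) h_a(-1)²𝟏` of `𝓗⁺`. -/
def omegaV {ℓ : ℕ} (A : VOA V) (hgen : Fin ℓ → V) (a : Fin ℓ) : V :=
  (1 / 2 : ℂ) • SV A hgen a a 1 1

/-- The element `J_a = h_a(-1)⁴𝟏 - 2h_a(-3)h_a(-1)𝟏 + (3/2)h_a(-2)²𝟏` of `𝓗⁺`. -/
def JV {ℓ : ℕ} (A : VOA V) (hgen : Fin ℓ → V) (a : Fin ℓ) : V :=
  A.Y (hgen a) (-1) (A.Y (hgen a) (-1) (A.Y (hgen a) (-1) (A.Y (hgen a) (-1) A.one)))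
    - (2 : ℂ) • SV A hgen a a 3 1 + (3 / 2 : ℂ) • SV A hgen a a 2 2

variable {W : Type} [AddCommGroup W] [Module ℂ W]

/-- `E^u_{ab}` (for `a ≠ b`), as a combination of the `S_{ab}(1,m)`. -/
def EuW {ℓ : ℕ} (s : Fin ℓ → Fin ℓ → ℤ → ℤ → W) (a b : Fin ℓ) : W :=
  (5 : ℂ) • s a b 1 2 + (25 : ℂ) • s a b 1 3 + (36 : ℂ) • s a b 1 4 + (16 : ℂ) • s a b 1 5

/-- `E^t_{ab}` (for `a ≠ b`), as a combination of the `S_{ab}(1,m)`. -/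
def EtW {ℓ : ℕ} (s : Fin ℓ → Fin ℓ → ℤ → ℤ → W) (a b : Fin ℓ) : W :=
  (-16 : ℂ) • ((3 : ℂ) • s a b 1 2 + (14 : ℂ) • s a b 1 3 + (19 : ℂ) • s a b 1 4
    + (8 : ℂ) • s a b 1 5)

/-- `Λ_{ab}` (for `a ≠ b`), as a combination of the `S_{ab}(1,m)`. -/
def LamW {ℓ : ℕ} (s : Fin ℓ → Fin ℓ → ℤ → ℤ → W) (a b : Fin ℓ) : W :=
  (45 : ℂ) • s a b 1 2 + (190 : ℂ) • s a b 1 3 + (240 : ℂ) • s a b 1 4 + (96 : ℂ) • s a b 1 5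

/-- The full setting of the paper: `A = 𝓗` is the rank `ℓ` free bosonic vertex
operator algebra with Heisenberg generators `hgen`, `θ` is its `-1` involution,
and `B = 𝓗⁺` is the fixed point vertex operator subalgebra, embedded by `ι`. -/
structure HeisenbergPlusSetting (ℓ : ℕ) (V W : Type) [AddCommGroup V] [Module ℂ V]
    [AddCommGroup W] [Module ℂ W] : Type where
  A : VOA V
  hgen : Fin ℓ → V
  heis : IsHeisenberg A hgen
  θ : V ≃ₗ[ℂ] V
  thetaAut : IsThetaAut A hgen θ
  B : VOA W
  ι : W →ₗ[ℂ] V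
  fixedSub : IsFixedSubVOA A θ B ι

/-- Bundled weak module over a vertex operator algebra. -/
structure ARep (A : VOA V) : Type 1 where
  carrier : Type
  [acg : AddCommGroup carrier]
  [mod : Module ℂ carrier]
  str : WkMod A carrier

attribute [instance] ARep.acg ARep.mod

/-- Bundled admissible module over a vertex operator algebra. -/
structure BRep (A : VOA V) : Type 1 where
  carrier : Type
  [acg : AddCommGroup carrier]
  [mod : Module ℂ carrier]
  adm : AdmMod A carrier

attribute [instance] BRep.acg BRep.mod

/-- Bundled twisted module over a vertex operator algebra with involution. -/
structure TwRep (A : VOA V) (θ : V ≃ₗ[ℂ] V) : Type 1 where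
  carrier : Type
  [acg : AddCommGroup carrier]
  [mod : Module ℂ carrier]
  str : TwMod A θ carrier

attribute [instance] TwRep.acg TwRep.mod

end


theorem zh_zchoose_zero (m : ℤ) : zchoose m 0 = 1 := by simp [zchoose, qchoose]

theorem zh_zchoose_succ (m : ℤ) (n : ℕ) :
    ((n : ℂ) + 1) * zchoose m (n + 1) = ((m : ℂ) - n) * zchoose m n := by
  have h : ((n : ℂ) + 1) ≠ 0 := by exact_mod_cast Nat.succ_ne_zero n
  simp only [zchoose, qchoose]
  push_cast
  field_simp

theorem zh_zchoose_eq (m : ℤ) (n : ℕ) : zchoose m n = ((Ring.choose m n : ℤ) : ℂ) := by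
  induction n with
  | zero => simp [zh_zchoose_zero]
  | succ n ih =>
    have h : ((n : ℂ) + 1) ≠ 0 := by exact_mod_cast Nat.succ_ne_zero n
    apply mul_left_cancel₀ h
    rw [zh_zchoose_succ, ih]
    have h1 := Ring.descPochhammer_eq_factorial_smul_choose m n
    have h2 := Ring.descPochhammer_eq_factorial_smul_choose m (n + 1)
    rw [descPochhammer_succ_right, Polynomial.smeval_mul, h1] at h2
    simp only [Polynomial.smeval_sub, Polynomial.smeval_X, Polynomial.smeval_natCast,
      Nat.factorial_succ, nsmul_eq_mul, pow_one, pow_zero, mul_one] at h2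
    push_cast at h2
    have h3 : ((n.factorial : ℤ)) ≠ 0 := by exact_mod_cast Nat.factorial_ne_zero n
    have h4 : (m - n) * Ring.choose m n = ((n : ℤ) + 1) * Ring.choose m (n + 1) := by
      apply mul_left_cancel₀ h3
      linarith
    exact_mod_cast h4

theorem zh_pascal (m : ℤ) (n : ℕ) :
    zchoose (m + 1) (n + 1) = zchoose m n + zchoose m (n + 1) := by
  simp only [zh_zchoose_eq, Ring.choose_succ_succ]
  push_cast
  ring

theorem zh_zchoose_zero_left (n : ℕ) : zchoose 0 n = if n = 0 then 1 else 0 := by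
  rw [zh_zchoose_eq, Ring.choose_zero_ite]
  split_ifs <;> simp

theorem zh_binomialSeries_sum {ι : Type*} (s : Finset ι) (k : ι → ℤ) :
    PowerSeries.binomialSeries ℂ (∑ i ∈ s, k i)
      = ∏ i ∈ s, PowerSeries.binomialSeries ℂ (k i) := by
  classical
  induction s using Finset.induction_on with
  | empty => simp
  | insert a s ha ih => rw [Finset.sum_insert ha, Finset.prod_insert ha, ← ih,
      PowerSeries.binomialSeries_add]

/-- Multivariable Vandermonde identity. -/
theorem zh_vandermonde {ι : Type*} [Fintype ι] [DecidableEq ι] (k : ι → ℤ) (M : ℕ) :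
    zchoose (∑ i, k i) M
      = ∑ a ∈ Finset.piAntidiag (Finset.univ : Finset ι) M, ∏ i, zchoose (k i) (a i) := by
  have h := congrArg (PowerSeries.coeff M) (zh_binomialSeries_sum Finset.univ k)
  rw [PowerSeries.coeff_prod] at h
  simp only [PowerSeries.binomialSeries_coeff, zsmul_eq_mul, mul_one, ← zh_zchoose_eq] at h
  rw [h]
  refine Finset.sum_bij' (fun f _ => (f : ι → ℕ)) (fun a _ => Finsupp.equivFunOnFinite.symm a)
    ?_ ?_ ?_ ?_ ?_
  · intro f hf
    simpa [Finset.mem_finsuppAntidiag] using hf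
  · intro f hf
    simpa [Finset.mem_finsuppAntidiag] using hf
  · intro f hf
    ext i; simp
  · intro f hf
    simp
  · intro f hf
    rfl

theorem zh_combi {ι : Type*} [Fintype ι] [DecidableEq ι] {E : Type*} [AddCommGroup E]
    [Module ℂ E] (k : ι → ℤ) (P : (ι → ℕ) → E) (M : ℕ) :
    ∑ c ∈ Finset.piAntidiag (Finset.univ : Finset ι) M,
      ∑ ab ∈ Fintype.piFinset (fun i => Finset.HasAntidiagonal.antidiagonal (c i)),
        (∏ i, zchoose (k i) (ab i).1) • P (fun i => (ab i).2)
      = ∑ AB ∈ Finset.HasAntidiagonal.antidiagonal M, zchoose (∑ i, k i) AB.1 •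
          ∑ b ∈ Finset.piAntidiag (Finset.univ : Finset ι) AB.2, P b := by
  have hR : ∀ AB : ℕ × ℕ, zchoose (∑ i, k i) AB.1 •
          ∑ b ∈ Finset.piAntidiag (Finset.univ : Finset ι) AB.2, P b
      = ∑ ab ∈ (Finset.piAntidiag (Finset.univ : Finset ι) AB.1) ×ˢ
          (Finset.piAntidiag (Finset.univ : Finset ι) AB.2),
          (∏ i, zchoose (k i) (ab.1 i)) • P ab.2 := by
    intro AB
    rw [zh_vandermonde, Finset.sum_product, Finset.sum_smul]
    simp only [Finset.smul_sum]
  simp only [hR]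
  rw [Finset.sum_sigma', Finset.sum_sigma']
  refine Finset.sum_bij'
    (fun x _ => ⟨(∑ i, (x.2 i).1, ∑ i, (x.2 i).2), (fun i => (x.2 i).1, fun i => (x.2 i).2)⟩)
    (fun x _ => ⟨fun i => x.2.1 i + x.2.2 i, fun i => (x.2.1 i, x.2.2 i)⟩) ?_ ?_ ?_ ?_ ?_
  · rintro ⟨c, ab⟩ h
    simp only [Finset.mem_sigma, Finset.mem_piAntidiag, Fintype.mem_piFinset,
      Finset.HasAntidiagonal.mem_antidiagonal, Finset.mem_product, ← Finset.sum_add_distrib] at h ⊢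
    refine ⟨?_, ⟨by simp, by simp⟩, ⟨by simp, by simp⟩⟩
    rw [← h.1.1]
    exact Finset.sum_congr rfl fun i _ => h.2 i
  · rintro ⟨⟨A, B⟩, ⟨a, b⟩⟩ h
    simp only [Finset.mem_sigma, Finset.mem_piAntidiag, Fintype.mem_piFinset,
      Finset.HasAntidiagonal.mem_antidiagonal, Finset.mem_product, Finset.sum_add_distrib] at h ⊢
    refine ⟨⟨?_, by simp⟩, fun i => by simp⟩
    rw [h.2.1.1, h.2.2.1, h.1]
  · rintro ⟨c, ab⟩ h
    simp only [Finset.mem_sigma, Finset.mem_piAntidiag, Fintype.mem_piFinset,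
      Finset.HasAntidiagonal.mem_antidiagonal] at h
    have : (fun i => (ab i).1 + (ab i).2) = c := funext h.2
    subst this
    rfl
  · rintro ⟨⟨A, B⟩, ⟨a, b⟩⟩ h
    simp only [Finset.mem_sigma, Finset.mem_piAntidiag,
      Finset.HasAntidiagonal.mem_antidiagonal, Finset.mem_product] at h
    obtain ⟨h0, ⟨rfl, -⟩, ⟨rfl, -⟩⟩ := h
    rfl
  · rintro ⟨c, ab⟩ h
    rfl

section ZhRes

variable {V : Type} [AddCommGroup V] [Module ℂ V]

/-- `Res_z (1+z)^k z^{-1-r} Y(u,z)v`. -/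
noncomputable def zhRes (A : VOA V) (r k : ℤ) (u v : V) : V :=
  ∑ᶠ i : ℕ, zchoose k i • A.Y u ((i : ℤ) - 1 - r) v

theorem zh_mulAux_eq (A : VOA V) (k : ℤ) (u v : V) : A.mulAux k u v = zhRes A 0 k u v := by
  simp [VOA.mulAux, zhRes]

theorem zh_circAux_eq (A : VOA V) (k : ℤ) (u v : V) : A.circAux k u v = zhRes A 1 k u v := by
  simp only [VOA.circAux, zhRes]
  refine finsum_congr fun i => ?_
  rw [show (i : ℤ) - 1 - 1 = i - 2 by ring]

theorem zhRes_eq_sum (A : VOA V) (r k : ℤ) (u v : V) (N : ℤ)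
    (h : ∀ n : ℤ, N ≤ n → A.Y u n v = 0) (L : ℕ) (hL : N + 1 + r ≤ L) :
    zhRes A r k u v = ∑ i ∈ Finset.range L, zchoose k i • A.Y u ((i : ℤ) - 1 - r) v := by
  refine finsum_eq_sum_of_support_subset _ ?_
  intro i hi
  simp only [Finset.coe_range, Set.mem_Iio]
  by_contra hlt
  apply hi
  simp only
  rw [h _ (by omega), smul_zero]

theorem zh_trunc_nat (A : VOA V) (u v : V) :
    ∃ N : ℕ, ∀ n : ℤ, (N : ℤ) ≤ n → A.Y u n v = 0 := by
  obtain ⟨N, hN⟩ := A.trunc u v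
  exact ⟨N.toNat, fun n hn => hN n (by omega)⟩

theorem zhRes_exists (A : VOA V) (r : ℤ) (u v : V) :
    ∃ L0 : ℕ, ∀ L : ℕ, L0 ≤ L → ∀ k : ℤ,
    zhRes A r k u v = ∑ i ∈ Finset.range L, zchoose k i • A.Y u ((i : ℤ) - 1 - r) v := by
  obtain ⟨N, hN⟩ := zh_trunc_nat A u v
  exact ⟨((N : ℤ) + 1 + r).toNat, fun L hL k => zhRes_eq_sum A r k u v N hN L (by omega)⟩

theorem zhRes_add_left (A : VOA V) (r k : ℤ) (u u' v : V) :
    zhRes A r k (u + u') v = zhRes A r k u v + zhRes A r k u' v := by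
  obtain ⟨L1, h1⟩ := zhRes_exists A r u v
  obtain ⟨L2, h2⟩ := zhRes_exists A r u' v
  obtain ⟨L3, h3⟩ := zhRes_exists A r (u + u') v
  rw [h1 (L1 + L2 + L3) (by omega), h2 (L1 + L2 + L3) (by omega), h3 (L1 + L2 + L3) (by omega),
    ← Finset.sum_add_distrib]
  simp

theorem zhRes_add_right (A : VOA V) (r k : ℤ) (u v v' : V) :
    zhRes A r k u (v + v') = zhRes A r k u v + zhRes A r k u v' := by
  obtain ⟨L1, h1⟩ := zhRes_exists A r u v
  obtain ⟨L2, h2⟩ := zhRes_exists A r u v'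
  obtain ⟨L3, h3⟩ := zhRes_exists A r u (v + v')
  rw [h1 (L1 + L2 + L3) (by omega), h2 (L1 + L2 + L3) (by omega), h3 (L1 + L2 + L3) (by omega),
    ← Finset.sum_add_distrib]
  simp

theorem zhRes_smul_left (A : VOA V) (r k : ℤ) (c : ℂ) (u v : V) :
    zhRes A r k (c • u) v = c • zhRes A r k u v := by
  obtain ⟨L1, h1⟩ := zhRes_exists A r u v
  obtain ⟨L3, h3⟩ := zhRes_exists A r (c • u) v
  rw [h1 (L1 + L3) (by omega), h3 (L1 + L3) (by omega), Finset.smul_sum]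
  refine Finset.sum_congr rfl fun i _ => ?_
  rw [smul_comm c]
  simp

theorem zhRes_smul_right (A : VOA V) (r k : ℤ) (c : ℂ) (u v : V) :
    zhRes A r k u (c • v) = c • zhRes A r k u v := by
  obtain ⟨L1, h1⟩ := zhRes_exists A r u v
  obtain ⟨L3, h3⟩ := zhRes_exists A r u (c • v)
  rw [h1 (L1 + L3) (by omega), h3 (L1 + L3) (by omega), Finset.smul_sum]
  refine Finset.sum_congr rfl fun i _ => ?_
  rw [smul_comm c]
  simp

theorem zhRes_zero_left (A : VOA V) (r k : ℤ) (v : V) : zhRes A r k 0 v = 0 := by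
  simpa using zhRes_smul_left A r k 0 0 v

/-- finite form with an antidiagonal -/
theorem zhRes_antidiag (A : VOA V) (k : ℤ) (u v : V) (N : ℕ)
    (h : ∀ n : ℤ, (N : ℤ) ≤ n → A.Y u n v = 0) (c : ℕ) :
    zhRes A ((c : ℤ) - N) k u v
      = ∑ ab ∈ Finset.HasAntidiagonal.antidiagonal c,
          zchoose k ab.1 • A.Y u ((N : ℤ) - 1 - ab.2) v := by
  rw [zhRes_eq_sum A _ k u v N h (c + 1) (by push_cast; omega),
    Finset.Nat.sum_antidiagonal_eq_sum_range_succ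
      (f := fun a b => zchoose k a • A.Y u ((N : ℤ) - 1 - b) v)]
  refine Finset.sum_congr rfl fun i hi => ?_
  rw [Finset.mem_range] at hi
  rw [show (i : ℤ) - 1 - (c - N) = N - 1 - ((c - i : ℕ) : ℤ) by omega]

theorem zhRes_one (A : VOA V) (r : ℤ) (v : V) :
    zhRes A r 0 A.one v = if r = 0 then v else 0 := by
  unfold zhRes
  rw [finsum_eq_single _ 0]
  · rw [zh_zchoose_zero, A.vacuum_act]
    by_cases hr : r = 0
    · simp [hr]
    · rw [if_neg hr, if_neg (by push_cast; omega)]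
      simp
  · intro i hi
    rw [zh_zchoose_zero_left, if_neg hi, zero_smul]

theorem zhRes_rec (A : VOA V) (r k : ℤ) (u v : V) :
    zhRes A r (k + 1) (A.Y A.omega 0 u) v
      = ((r : ℂ) + 1) • zhRes A (r + 1) k u v + ((r : ℂ) - k) • zhRes A r k u v := by
  obtain ⟨L1, h1⟩ := zhRes_exists A r (A.Y A.omega 0 u) v
  obtain ⟨L2, h2⟩ := zhRes_exists A (r + 1) u v
  obtain ⟨L3, h3⟩ := zhRes_exists A r u v
  rw [h1 (L1 + L2 + L3 + 1) (by omega), h2 (L1 + L2 + L3 + 1) (by omega),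
    h3 (L1 + L2 + L3) (by omega), Finset.sum_range_succ', Finset.sum_range_succ', smul_add,
    Finset.smul_sum, Finset.smul_sum]
  refine Eq.trans ?_ (add_right_comm _ _ _)
  rw [← Finset.sum_add_distrib]
  congr 1
  · refine Finset.sum_congr rfl fun i _ => ?_
    rw [A.translation]
    rw [show ((i + 1 : ℕ) : ℤ) - 1 - r - 1 = i - 1 - r by push_cast; ring,
      show ((i + 1 : ℕ) : ℤ) - 1 - (r + 1) = i - 1 - r by push_cast; ring]
    simp only [LinearMap.smul_apply, smul_smul, ← add_smul]
    congr 1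
    have hs := zh_zchoose_succ k i
    rw [zh_pascal]
    push_cast
    linear_combination (-1 : ℂ) * hs
  · rw [A.translation]
    rw [show ((0 : ℕ) : ℤ) - 1 - r - 1 = ((0 : ℕ) : ℤ) - 1 - (r + 1) by ring]
    simp only [LinearMap.smul_apply, smul_smul, zh_zchoose_zero]
    congr 1
    push_cast
    ring

theorem zhRes_mem_Osub (A : VOA V) (r : ℕ) : ∀ (k : ℤ) (u v : V), u ∈ A.wt k →
    zhRes A ((r : ℤ) + 1) k u v ∈ A.Osub := by
  induction r with
  | zero =>
    intro k u v hu
    refine Submodule.subset_span ⟨k, u, v, hu, ?_⟩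
    rw [zh_circAux_eq]; simp
  | succ r ih =>
    intro k u v hu
    have hD : A.Y A.omega 0 u ∈ A.wt (k + 1) := by
      have := A.mode_wt 2 A.omega A.omega_wt k 0 u hu
      rwa [show k + 2 - 0 - 1 = k + 1 by ring] at this
    have hrec := zhRes_rec A ((r : ℤ) + 1) k u v
    have hne : (((r : ℤ) + 1 : ℤ) : ℂ) + 1 ≠ 0 := by
      exact_mod_cast (by omega : ((r : ℤ) + 1) + 1 ≠ 0)
    have h1 : ((((r : ℤ) + 1 : ℤ) : ℂ) + 1) • zhRes A ((r : ℤ) + 1 + 1) k u v ∈ A.Osub := by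
      rw [← sub_eq_iff_eq_add] at hrec
      rw [← hrec]
      exact Submodule.sub_mem _ (ih _ _ _ hD) (Submodule.smul_mem _ _ (ih _ _ _ hu))
    have h2 := (Submodule.smul_mem_iff _ hne).1 h1
    exact_mod_cast h2

theorem zhRes_mem_Osub' (A : VOA V) (r : ℤ) (hr : 1 ≤ r) (k : ℤ) (u v : V) (hu : u ∈ A.wt k) :
    zhRes A r k u v ∈ A.Osub := by
  have := zhRes_mem_Osub A (r - 1).toNat k u v hu
  rwa [show (((r - 1).toNat : ℕ) : ℤ) + 1 = r by omega] at this

theorem zh_hcomp_of_mem (A : VOA V) (k : ℤ) (u : V) (hu : u ∈ A.wt k) (j : ℤ) :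
    A.hcomp j u = if j = k then u else 0 := by
  have h : A.decompose u = DirectSum.lof ℂ ℤ (fun n => A.wt n) k ⟨u, hu⟩ := by
    unfold VOA.decompose
    rw [LinearEquiv.symm_apply_eq]
    change u = DirectSum.coeLinearMap A.wt _
    rw [DirectSum.coeLinearMap_lof]
  unfold VOA.hcomp
  rw [h]
  by_cases hj : j = k
  · subst hj
    rw [DirectSum.lof_apply, if_pos rfl]
  · rw [if_neg hj, DirectSum.lof_eq_of, DirectSum.of_eq_of_ne _ _ _ hj]
    rfl

theorem zh_hcomp_mem (A : VOA V) (k : ℤ) (u : V) : A.hcomp k u ∈ A.wt k := (A.decompose u k).2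

theorem zh_hcomp_finite (A : VOA V) (u : V) : {k : ℤ | A.hcomp k u ≠ 0}.Finite := by
  classical
  refine (DFinsupp.support (A.decompose u)).finite_toSet.subset ?_
  intro k hk
  simp only [Finset.mem_coe, DFinsupp.mem_support_toFun]
  intro h0
  apply hk
  unfold VOA.hcomp
  rw [h0]
  rfl

theorem zh_hcomp_sum (A : VOA V) (u : V) :
    ∃ s : Finset ℤ, u = ∑ k ∈ s, A.hcomp k u := by
  classical
  refine ⟨DFinsupp.support (A.decompose u), ?_⟩
  have h : DirectSum.coeLinearMap A.wt (A.decompose u) = u :=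
    (LinearEquiv.ofBijective (DirectSum.coeLinearMap A.wt) A.internal).apply_symm_apply u
  conv_lhs => rw [← h]
  rw [DirectSum.coeLinearMap_eq_dfinsuppSum]
  rfl

/-- bilinear extension of `zhRes` -/
noncomputable def zhFull (A : VOA V) (r : ℤ) (u v : V) : V :=
  ∑ᶠ k : ℤ, zhRes A r k (A.hcomp k u) v

theorem zh_star_eq (A : VOA V) (u v : V) : A.star u v = zhFull A 0 u v := by
  unfold VOA.star zhFull
  simp only [zh_mulAux_eq]

theorem zhFull_of_mem (A : VOA V) (r k : ℤ) (u v : V) (hu : u ∈ A.wt k) :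
    zhFull A r u v = zhRes A r k u v := by
  unfold zhFull
  rw [finsum_eq_single _ k]
  · rw [zh_hcomp_of_mem A k u hu, if_pos rfl]
  · intro j hj
    rw [zh_hcomp_of_mem A k u hu, if_neg hj, zhRes_zero_left]

theorem zhFull_support (A : VOA V) (r : ℤ) (u v : V) :
    (Function.support fun k : ℤ => zhRes A r k (A.hcomp k u) v).Finite := by
  refine (zh_hcomp_finite A u).subset ?_
  intro k hk h0
  apply hk
  simp only
  rw [h0, zhRes_zero_left]

theorem zh_hcomp_add (A : VOA V) (k : ℤ) (u u' : V) :
    A.hcomp k (u + u') = A.hcomp k u + A.hcomp k u' := by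
  simp [VOA.hcomp]

theorem zh_hcomp_smul (A : VOA V) (k : ℤ) (c : ℂ) (u : V) :
    A.hcomp k (c • u) = c • A.hcomp k u := by
  simp only [VOA.hcomp, map_smul]
  rfl

/-- bundled version -/
noncomputable def zhBil (A : VOA V) (r : ℤ) : V →ₗ[ℂ] V →ₗ[ℂ] V :=
  LinearMap.mk₂ ℂ (zhFull A r)
    (fun u u' v => by
      unfold zhFull
      rw [← finsum_add_distrib (zhFull_support A r u v) (zhFull_support A r u' v)]
      simp only [zh_hcomp_add, zhRes_add_left])
    (fun c u v => by
      unfold zhFull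
      rw [smul_finsum' c (zhFull_support A r u v)]
      simp only [zh_hcomp_smul, zhRes_smul_left])
    (fun u v v' => by
      unfold zhFull
      rw [← finsum_add_distrib (zhFull_support A r u v) (zhFull_support A r u v')]
      simp only [zhRes_add_right])
    (fun c u v => by
      unfold zhFull
      rw [smul_finsum' c (zhFull_support A r u v)]
      simp only [zhRes_smul_right])

end ZhRes

section ZhTensor

variable {n : ℕ} {Vf : Fin n → Type} [∀ i, AddCommGroup (Vf i)] [∀ i, Module ℂ (Vf i)]

/-- the mode hypothesis of the tensor product VOA -/
def ZhMode (As : ∀ i, VOA (Vf i)) (T : VOA (⨂[ℂ] i, Vf i)) : Prop :=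
  ∀ (v w : ∀ i, Vf i) (m : ℤ),
      T.Y (PiTensorProduct.tprod ℂ v) m (PiTensorProduct.tprod ℂ w)
        = ∑ᶠ kk : {kk : Fin n → ℤ // (∑ i, kk i) = m - ((n : ℤ) - 1)},
            PiTensorProduct.tprod ℂ fun i => (As i).Y (v i) (kk.1 i) (w i)

theorem zh_mode_fin (As : ∀ i, VOA (Vf i)) (T : VOA (⨂[ℂ] i, Vf i)) (hmode : ZhMode As T)
    (v w : ∀ i, Vf i) (N : ℕ)
    (hN : ∀ (i : Fin n) (m : ℤ), (N : ℤ) ≤ m → (As i).Y (v i) m (w i) = 0) (B : ℕ) :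
    T.Y (PiTensorProduct.tprod ℂ v) (((n * N : ℕ) : ℤ) - 1 - B) (PiTensorProduct.tprod ℂ w)
      = ∑ b ∈ Finset.piAntidiag (Finset.univ : Finset (Fin n)) B,
          PiTensorProduct.tprod ℂ fun i => (As i).Y (v i) ((N : ℤ) - 1 - b i) (w i) := by
  classical
  rw [hmode v w]
  have hsum : ∀ b : Fin n → ℕ, (∑ i, ((N : ℤ) - 1 - b i))
      = n * N - n - ((∑ i, b i : ℕ) : ℤ) := by
    intro b
    rw [Finset.sum_sub_distrib, Finset.sum_const]
    simp
    ring
  let e : {b // b ∈ Finset.piAntidiag (Finset.univ : Finset (Fin n)) B} →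
      {kk : Fin n → ℤ // (∑ i, kk i) = ((n * N : ℕ) : ℤ) - 1 - B - ((n : ℤ) - 1)} :=
    fun b => ⟨fun i => (N : ℤ) - 1 - b.1 i, by
      have hb := (Finset.mem_piAntidiag.1 b.2).1
      rw [hsum, hb]
      push_cast
      ring⟩
  have he : Function.Injective e := by
    intro b b' h
    apply Subtype.ext
    funext i
    have := congrFun (congrArg Subtype.val h) i
    simp only [e] at this
    omega
  rw [finsum_eq_sum_of_support_subset
    (s := (Finset.piAntidiag (Finset.univ : Finset (Fin n)) B).attach.image e)]
  · rw [Finset.sum_image (fun a _ b _ h => he h),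
      ← Finset.sum_attach (Finset.piAntidiag (Finset.univ : Finset (Fin n)) B)]
  · intro kk hkk
    have hlt : ∀ i, kk.1 i < N := by
      intro i
      by_contra hge
      apply hkk
      exact (PiTensorProduct.tprod ℂ).map_coord_zero i (hN i _ (by omega))
    let b : Fin n → ℕ := fun i => ((N : ℤ) - 1 - kk.1 i).toNat
    have hb : ∀ i, (N : ℤ) - 1 - b i = kk.1 i := by
      intro i
      have := hlt i
      simp only [b]
      omega
    have hbB : ∑ i, b i = B := by
      have h1 := hsum b
      simp only [hb] at h1
      rw [kk.2] at h1
      push_cast at h1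
      have h2 : ((∑ i, b i : ℕ) : ℤ) = B := by push_cast; linarith
      exact_mod_cast h2
    rw [Finset.mem_coe, Finset.mem_image]
    refine ⟨⟨b, by simp [hbB]⟩, Finset.mem_attach _ _, ?_⟩
    apply Subtype.ext
    funext i
    exact hb i

theorem zh_mode_trunc (As : ∀ i, VOA (Vf i)) (T : VOA (⨂[ℂ] i, Vf i)) (hmode : ZhMode As T)
    (v w : ∀ i, Vf i) (N : ℕ)
    (hN : ∀ (i : Fin n) (m : ℤ), (N : ℤ) ≤ m → (As i).Y (v i) m (w i) = 0) (m : ℤ)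
    (hm : ((n * N : ℕ) : ℤ) ≤ m) :
    T.Y (PiTensorProduct.tprod ℂ v) m (PiTensorProduct.tprod ℂ w) = 0 := by
  rw [hmode v w]
  refine finsum_eq_zero_of_forall_eq_zero ?_
  rintro ⟨kk, hkk⟩
  have : ∃ i, (N : ℤ) ≤ kk i := by
    by_contra! hlt
    have h1 : ∑ i, kk i ≤ ∑ _i : Fin n, ((N : ℤ) - 1) :=
      Finset.sum_le_sum fun i _ => by have := hlt i; omega
    rw [hkk, Finset.sum_const] at h1
    simp only [Finset.card_univ, Fintype.card_fin, nsmul_eq_mul] at h1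
    push_cast at hm
    linarith
  obtain ⟨i, hi⟩ := this
  exact (PiTensorProduct.tprod ℂ).map_coord_zero i (hN i _ hi)

theorem zh_key (As : ∀ i, VOA (Vf i)) (T : VOA (⨂[ℂ] i, Vf i)) (hmode : ZhMode As T)
    (v w : ∀ i, Vf i) (N : ℕ)
    (hN : ∀ (i : Fin n) (m : ℤ), (N : ℤ) ≤ m → (As i).Y (v i) m (w i) = 0)
    (kk : Fin n → ℤ) (r : ℕ) :
    zhRes T r (∑ i, kk i) (PiTensorProduct.tprod ℂ v) (PiTensorProduct.tprod ℂ w)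
      = ∑ c ∈ Finset.piAntidiag (Finset.univ : Finset (Fin n)) (r + n * N),
          PiTensorProduct.tprod ℂ fun i => zhRes (As i) ((c i : ℤ) - N) (kk i) (v i) (w i) := by
  have h1 := zhRes_antidiag T (∑ i, kk i) (PiTensorProduct.tprod ℂ v) (PiTensorProduct.tprod ℂ w)
    (n * N) (zh_mode_trunc As T hmode v w N hN) (r + n * N)
  rw [show (((r + n * N : ℕ) : ℤ)) - ((n * N : ℕ) : ℤ) = r by push_cast; ring] at h1
  rw [h1]
  simp only [zh_mode_fin As T hmode v w N hN]
  rw [← zh_combi kk (fun b => PiTensorProduct.tprod ℂ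
    fun i => (As i).Y (v i) ((N : ℤ) - 1 - b i) (w i))]
  refine Finset.sum_congr rfl fun c _ => ?_
  have h2 : ∀ i, zhRes (As i) ((c i : ℤ) - N) (kk i) (v i) (w i) = _ :=
    fun i => zhRes_antidiag (As i) (kk i) (v i) (w i) N (hN i) (c i)
  simp only [h2]
  rw [MultilinearMap.map_sum_finset]
  refine Finset.sum_congr rfl fun ab _ => ?_
  rw [MultilinearMap.map_smul_univ]

theorem zh_common_trunc (As : ∀ i, VOA (Vf i)) (v w : ∀ i, Vf i) :
    ∃ N : ℕ, ∀ (i : Fin n) (m : ℤ), (N : ℤ) ≤ m → (As i).Y (v i) m (w i) = 0 := by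
  choose N hN using fun i => zh_trunc_nat (As i) (v i) (w i)
  refine ⟨∑ i, N i, fun i m hm => hN i m ?_⟩
  have : N i ≤ ∑ i, N i := Finset.single_le_sum (f := N) (fun _ _ => Nat.zero_le _)
    (Finset.mem_univ i)
  omega

theorem zh_span_homog (As : ∀ i, VOA (Vf i)) :
    Submodule.span ℂ {x : ⨂[ℂ] i, Vf i | ∃ (kk : Fin n → ℤ) (v : ∀ i, Vf i),
      (∀ i, v i ∈ (As i).wt (kk i)) ∧ x = PiTensorProduct.tprod ℂ v} = ⊤ := by
  rw [eq_top_iff, ← PiTensorProduct.span_tprod_eq_top, Submodule.span_le]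
  rintro _ ⟨v, rfl⟩
  choose s hs using fun i => zh_hcomp_sum (As i) (v i)
  have h : PiTensorProduct.tprod ℂ v
      = PiTensorProduct.tprod ℂ (fun i => ∑ k ∈ s i, (As i).hcomp k (v i)) :=
    congrArg _ (funext hs)
  rw [h, MultilinearMap.map_sum_finset]
  refine Submodule.sum_mem _ fun kk _ => Submodule.subset_span ⟨kk, _, fun i => ?_, rfl⟩
  exact zh_hcomp_mem _ _ _

/-- two bilinear maps on the tensor product agree if they agree on homogeneous tensors -/
theorem zh_bil_ext (As : ∀ i, VOA (Vf i)) {E : Type*} [AddCommGroup E] [Module ℂ E]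
    (f g : (⨂[ℂ] i, Vf i) →ₗ[ℂ] (⨂[ℂ] i, Vf i) →ₗ[ℂ] E)
    (h : ∀ (kk : Fin n → ℤ) (v w : ∀ i, Vf i), (∀ i, v i ∈ (As i).wt (kk i)) →
      f (PiTensorProduct.tprod ℂ v) (PiTensorProduct.tprod ℂ w)
        = g (PiTensorProduct.tprod ℂ v) (PiTensorProduct.tprod ℂ w)) : f = g := by
  refine LinearMap.ext_on (zh_span_homog As) ?_
  rintro _ ⟨kk, v, hv, rfl⟩
  refine PiTensorProduct.ext ?_
  ext w
  exact h kk v w hv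

section Real

variable (As : ∀ i, VOA (Vf i)) (T : VOA (⨂[ℂ] i, Vf i)) (hmode : ZhMode As T)
    (hwt : ∀ (v : ∀ i, Vf i) (kk : Fin n → ℤ), (∀ i, v i ∈ (As i).wt (kk i)) →
      PiTensorProduct.tprod ℂ v ∈ T.wt (∑ i, kk i))
    {R : Fin n → Type} [∀ i, Ring (R i)] [∀ i, Algebra ℂ (R i)]
    (Z : ∀ i, ZhuRealization (As i) (R i))

theorem zh_pi_zero (i : Fin n) (r k : ℤ) (hr : 1 ≤ r) (u v : Vf i) (hu : u ∈ (As i).wt k) :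
    (Z i).π (zhRes (As i) r k u v) = 0 := by
  rw [← LinearMap.mem_ker, (Z i).ker_eq]
  exact zhRes_mem_Osub' _ r hr k u v hu

theorem zh_Phi_circ (hmode : ZhMode As T)
    (hwt : ∀ (v : ∀ i, Vf i) (kk : Fin n → ℤ), (∀ i, v i ∈ (As i).wt (kk i)) →
      PiTensorProduct.tprod ℂ v ∈ T.wt (∑ i, kk i)) :
    (zhBil T 1).compr₂ (PiTensorProduct.map fun i => (Z i).π) = 0 := by
  refine zh_bil_ext As _ _ fun kk v w hv => ?_
  obtain ⟨N, hN⟩ := zh_common_trunc As v w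
  change PiTensorProduct.map (fun i => (Z i).π) (zhFull T 1 _ _) = 0
  rw [zhFull_of_mem T 1 _ _ _ (hwt v kk hv)]
  have h := zh_key As T hmode v w N hN kk 1
  rw [Nat.cast_one] at h
  rw [h, map_sum]
  refine Finset.sum_eq_zero fun c hc => ?_
  rw [PiTensorProduct.map_tprod]
  have hc' := (Finset.mem_piAntidiag.1 hc).1
  have : ∃ i, N < c i := by
    by_contra! hle
    have h1 : ∑ i, c i ≤ ∑ _i : Fin n, N := Finset.sum_le_sum fun i _ => hle i
    rw [hc'] at h1
    simp at h1
  obtain ⟨i, hi⟩ := this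
  exact (PiTensorProduct.tprod ℂ).map_coord_zero i
    (zh_pi_zero As Z i _ _ (by omega) _ _ (hv i))

theorem zh_Phi_star (hmode : ZhMode As T)
    (hwt : ∀ (v : ∀ i, Vf i) (kk : Fin n → ℤ), (∀ i, v i ∈ (As i).wt (kk i)) →
      PiTensorProduct.tprod ℂ v ∈ T.wt (∑ i, kk i)) (x y : ⨂[ℂ] i, Vf i) :
    PiTensorProduct.map (fun i => (Z i).π) (T.star x y)
      = PiTensorProduct.map (fun i => (Z i).π) x * PiTensorProduct.map (fun i => (Z i).π) y := by
  have key : (zhBil T 0).compr₂ (PiTensorProduct.map fun i => (Z i).π)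
      = (LinearMap.mul ℂ (⨂[ℂ] i, R i)).compl₁₂ (PiTensorProduct.map fun i => (Z i).π)
          (PiTensorProduct.map fun i => (Z i).π) := by
    refine zh_bil_ext As _ _ fun kk v w hv => ?_
    obtain ⟨N, hN⟩ := zh_common_trunc As v w
    rw [LinearMap.compr₂_apply, LinearMap.compl₁₂_apply, LinearMap.mul_apply']
    change PiTensorProduct.map (fun i => (Z i).π) (zhFull T 0 _ _)
      = PiTensorProduct.map (fun i => (Z i).π) _ * PiTensorProduct.map (fun i => (Z i).π) _
    rw [zhFull_of_mem T 0 _ _ _ (hwt v kk hv)]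
    have h := zh_key As T hmode v w N hN kk 0
    rw [Nat.cast_zero] at h
    rw [h, map_sum, Finset.sum_eq_single (fun _ => N)]
    · simp only [PiTensorProduct.map_tprod, PiTensorProduct.tprod_mul_tprod, sub_self]
      congr 1
      funext i
      rw [Pi.mul_apply, ← (Z i).map_star, zh_star_eq, zhFull_of_mem _ 0 _ _ _ (hv i)]
    · intro c hc hne
      rw [PiTensorProduct.map_tprod]
      have hc' := (Finset.mem_piAntidiag.1 hc).1
      have : ∃ i, N < c i := by
        by_contra! hle
        apply hne
        have h1 : ∑ i, c i = ∑ _i : Fin n, N := by rw [hc']; simp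
        have h2 := (Finset.sum_eq_sum_iff_of_le (fun i _ => hle i)).1 h1
        funext i
        exact h2 i (Finset.mem_univ i)
      obtain ⟨i, hi⟩ := this
      exact (PiTensorProduct.tprod ℂ).map_coord_zero i
        (zh_pi_zero As Z i _ _ (by omega) _ _ (hv i))
    · intro hc
      exfalso
      apply hc
      simp
  have := LinearMap.congr_fun (LinearMap.congr_fun key x) y
  rw [zh_star_eq]
  exact this

theorem zh_Osub_le (hmode : ZhMode As T)
    (hwt : ∀ (v : ∀ i, Vf i) (kk : Fin n → ℤ), (∀ i, v i ∈ (As i).wt (kk i)) →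
      PiTensorProduct.tprod ℂ v ∈ T.wt (∑ i, kk i)) :
    T.Osub ≤ LinearMap.ker (PiTensorProduct.map fun i => (Z i).π) := by
  refine Submodule.span_le.2 ?_
  rintro _ ⟨k, u, v, hu, rfl⟩
  rw [SetLike.mem_coe, LinearMap.mem_ker, zh_circAux_eq, ← zhFull_of_mem T 1 k u v hu]
  exact LinearMap.congr_fun (LinearMap.congr_fun (zh_Phi_circ As T Z hmode hwt) u) v

theorem zh_tprod_Osub (hmode : ZhMode As T)
    (hwt : ∀ (v : ∀ i, Vf i) (kk : Fin n → ℤ), (∀ i, v i ∈ (As i).wt (kk i)) →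
      PiTensorProduct.tprod ℂ v ∈ T.wt (∑ i, kk i))
    (w : ∀ i, Vf i) (i : Fin n) (x : Vf i) (hx : x ∈ (As i).Osub) :
    PiTensorProduct.tprod ℂ (Function.update w i x) ∈ T.Osub := by
  suffices h : (As i).Osub ≤ T.Osub.comap ((PiTensorProduct.tprod ℂ).toLinearMap w i) from h hx
  refine Submodule.span_le.2 ?_
  rintro _ ⟨k, u, v, hu, rfl⟩
  change PiTensorProduct.tprod ℂ (Function.update w i _) ∈ T.Osub
  let u' : ∀ j, Vf j := Function.update (fun j => (As j).one) i u
  let w' : ∀ j, Vf j := Function.update w i v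
  let kk : Fin n → ℤ := Function.update 0 i k
  have hu' : ∀ j, u' j ∈ (As j).wt (kk j) := by
    intro j
    by_cases hj : j = i
    · subst hj; simpa [u', kk] using hu
    · simpa [u', kk, hj] using (As j).one_wt
  refine Submodule.subset_span ⟨∑ j, kk j, PiTensorProduct.tprod ℂ u',
    PiTensorProduct.tprod ℂ w', hwt u' kk hu', ?_⟩
  obtain ⟨N, hN⟩ := zh_common_trunc As u' w'
  have h := zh_key As T hmode u' w' N hN kk 1
  rw [Nat.cast_one] at h
  rw [zh_circAux_eq, zh_circAux_eq, h, Finset.sum_eq_single (fun j => if j = i then N + 1 else N)]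
  · congr 1
    funext j
    by_cases hj : j = i
    · subst hj
      simp [u', w', kk]
    · simp [u', w', kk, hj, zhRes_one]
  · intro c hc hne
    have hc' := (Finset.mem_piAntidiag.1 hc).1
    have : ∃ j, j ≠ i ∧ c j ≠ N := by
      by_contra! hall
      apply hne
      have h1 : ∑ j, c j = c i + ∑ j ∈ Finset.univ.erase i, c j :=
        (Finset.add_sum_erase _ _ (Finset.mem_univ i)).symm
      have h2 : ∑ _j : Fin n, N = N + ∑ j ∈ Finset.univ.erase i, N :=
        (Finset.add_sum_erase _ (fun _ => N) (Finset.mem_univ i)).symm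
      have h3 : ∑ j ∈ Finset.univ.erase i, c j = ∑ j ∈ Finset.univ.erase i, N :=
        Finset.sum_congr rfl fun j hj => hall j (Finset.ne_of_mem_erase hj)
      have h4 : ∑ _j : Fin n, N = n * N := by simp
      funext j
      by_cases hj : j = i
      · subst hj
        rw [if_pos rfl]
        linarith
      · rw [if_neg hj, hall j hj]
    obtain ⟨j, hj, hcj⟩ := this
    refine (PiTensorProduct.tprod ℂ).map_coord_zero j ?_
    have : (c j : ℤ) - N ≠ 0 := by omega
    simp [u', w', kk, hj, zhRes_one, this]
  · intro hc
    exfalso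
    apply hc
    rw [Finset.mem_piAntidiag]
    refine ⟨?_, by simp⟩
    have : ∀ j : Fin n, (if j = i then N + 1 else N) = (if j = i then 1 else 0) + N := by
      intro j; split_ifs <;> omega
    simp only [this, Finset.sum_add_distrib]
    simp

end Real

end ZhTensor

/-- Lemma 4.1.1, from [DMZ]. For vertex operator algebras
`V_1, …, V_n` (with `T` the tensor product vertex operator algebra structure on
`V_1 ⊗ ⋯ ⊗ V_n`, characterized by its vacuum, conformal vector, grading and
modes on pure tensors), the linear map `F` sending `[v_1] ⊗ ⋯ ⊗ [v_n]` to
`[v_1 ⊗ ⋯ ⊗ v_n]` is an isomorphism of associative algebras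
`A(V_1) ⊗ ⋯ ⊗ A(V_n) ≃ A(V_1 ⊗ ⋯ ⊗ V_n)`. -/
theorem statement6 (n : ℕ) (Vf : Fin n → Type)
    [∀ i, AddCommGroup (Vf i)] [∀ i, Module ℂ (Vf i)]
    (As : ∀ i, VOA (Vf i))
    (T : VOA (⨂[ℂ] i, Vf i))
    (hone : T.one = PiTensorProduct.tprod ℂ fun i => (As i).one)
    (homega : T.omega = ∑ i : Fin n, PiTensorProduct.tprod ℂ
      (fun j => if j = i then (As j).omega else (As j).one))
    (hmode : ∀ (v w : ∀ i, Vf i) (m : ℤ),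
      T.Y (PiTensorProduct.tprod ℂ v) m (PiTensorProduct.tprod ℂ w)
        = ∑ᶠ kk : {kk : Fin n → ℤ // (∑ i, kk i) = m - ((n : ℤ) - 1)},
            PiTensorProduct.tprod ℂ fun i => (As i).Y (v i) (kk.1 i) (w i))
    (hwt : ∀ (v : ∀ i, Vf i) (kk : Fin n → ℤ), (∀ i, v i ∈ (As i).wt (kk i)) →
      PiTensorProduct.tprod ℂ v ∈ T.wt (∑ i, kk i))
    (R : Fin n → Type) [∀ i, Ring (R i)] [∀ i, Algebra ℂ (R i)]
    (Z : ∀ i, ZhuRealization (As i) (R i))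
    (RT : Type) [Ring RT] [Algebra ℂ RT] (ZT : ZhuRealization T RT) :
    ∃ F : (⨂[ℂ] i, R i) ≃ₐ[ℂ] RT,
      ∀ v : ∀ i, Vf i,
        F (PiTensorProduct.tprod ℂ fun i => (Z i).π (v i))
          = ZT.π (PiTensorProduct.tprod ℂ v) := by
  classical
  let Φ : (⨂[ℂ] i, Vf i) →ₗ[ℂ] (⨂[ℂ] i, R i) := PiTensorProduct.map fun i => (Z i).π
  choose s hs using fun i => LinearMap.exists_rightInverse_of_surjective (Z i).π
    (LinearMap.range_eq_top.2 (Z i).surj)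
  let F0 : (⨂[ℂ] i, R i) →ₗ[ℂ] RT := ZT.π ∘ₗ PiTensorProduct.map s
  have hO : ∀ (w : ∀ i, Vf i) (i : Fin n) (x : Vf i), x ∈ (As i).Osub →
      ZT.π (PiTensorProduct.tprod ℂ (Function.update w i x)) = 0 := by
    intro w i x hx
    rw [← LinearMap.mem_ker, ZT.ker_eq]
    exact zh_tprod_Osub As T hmode hwt w i x hx
  have hF : ∀ v : ∀ i, Vf i, F0 (PiTensorProduct.tprod ℂ fun i => (Z i).π (v i))
      = ZT.π (PiTensorProduct.tprod ℂ v) := by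
    intro v
    change ZT.π (PiTensorProduct.map s _) = _
    rw [PiTensorProduct.map_tprod]
    have hgen : ∀ S : Finset (Fin n),
        ZT.π (PiTensorProduct.tprod ℂ (fun i => if i ∈ S then s i ((Z i).π (v i)) else v i))
          = ZT.π (PiTensorProduct.tprod ℂ v) := by
      intro S
      induction S using Finset.induction_on with
      | empty => simp
      | insert a S ha ih =>
        rw [← ih]
        set w : ∀ i, Vf i := fun i => if i ∈ S then s i ((Z i).π (v i)) else v i with hw
        have hwa : w a = v a := by simp [hw, ha]
        have h1 : (fun i => if i ∈ insert a S then s i ((Z i).π (v i)) else v i)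
            = Function.update w a (v a + (s a ((Z a).π (v a)) - v a)) := by
          funext i
          by_cases hi : i = a
          · subst hi; simp
          · simp [hi, hw]
        rw [h1, MultilinearMap.map_update_add, map_add, hO w a (s a ((Z a).π (v a)) - v a), add_zero, ← hwa,
          Function.update_eq_self]
        rw [← (Z a).ker_eq, LinearMap.mem_ker, map_sub]
        have := LinearMap.congr_fun (hs a) ((Z a).π (v a))
        simp only [LinearMap.comp_apply, LinearMap.id_apply] at this
        rw [this, sub_self]
    simpa using hgen Finset.univ
  have hFΦ : ∀ x, F0 (Φ x) = ZT.π x := by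
    intro x
    have : F0 ∘ₗ Φ = ZT.π := by
      refine PiTensorProduct.ext ?_
      ext v
      change F0 (PiTensorProduct.map _ _) = ZT.π _
      rw [PiTensorProduct.map_tprod]
      exact hF v
    exact LinearMap.congr_fun this x
  have hΦ : Function.Surjective Φ := by
    intro y
    refine ⟨PiTensorProduct.map s y, ?_⟩
    have h1 := PiTensorProduct.map_comp (R := ℂ) (fun i => (Z i).π) s
    simp only [hs, PiTensorProduct.map_id] at h1
    exact (LinearMap.congr_fun h1 y).symm
  have hmul : ∀ x y, F0 (x * y) = F0 x * F0 y := by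
    intro x y
    obtain ⟨x, rfl⟩ := hΦ x
    obtain ⟨y, rfl⟩ := hΦ y
    have h1 : Φ (T.star x y) = Φ x * Φ y := zh_Phi_star As T Z hmode hwt x y
    rw [← h1, hFΦ, hFΦ, hFΦ, ZT.map_star]
  have hone' : F0 1 = 1 := by
    have h1 : (1 : ⨂[ℂ] i, R i) = PiTensorProduct.tprod ℂ fun i => (Z i).π (As i).one := by
      rw [PiTensorProduct.one_def]
      congr 1
      funext i
      exact (Z i).map_one.symm
    rw [h1, hF, ← hone, ZT.map_one]
  refine ⟨AlgEquiv.ofBijective (AlgHom.ofLinearMap F0 hone' hmul) ⟨?_, ?_⟩, hF⟩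
  · rw [injective_iff_map_eq_zero]
    intro y hy
    obtain ⟨x, rfl⟩ := hΦ y
    have hy' : F0 (Φ x) = 0 := hy
    rw [hFΦ, ← LinearMap.mem_ker, ZT.ker_eq] at hy'
    exact zh_Osub_le As T Z hmode hwt hy'
  · intro z
    obtain ⟨x, rfl⟩ := ZT.surj z
    exact ⟨Φ x, hFΦ x⟩
end

section
/- Let 𝓦 = 𝓗_1^+⊗···⊗𝓗_ℓ^+ ⊆ 𝓗^+ and let A[𝓦] be the image of 𝓦 in A(𝓗^+). Then A[𝓦] is generated as an algebra by the elements [ω_a] and [J_a] for a = 1,…,ℓ; in particular A[𝓦] is a commutative subalgebra of A(𝓗^+). -/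
/-!
Common framework: vertex operator algebras over ℂ encoded via their modes,
weak/admissible/ordinary modules, twisted modules, Zhu's algebra data,
and the free bosonic (Heisenberg) vertex operator algebra `𝓗 = M(1)` of rank `ℓ`
together with its `θ`-fixed subalgebra `𝓗⁺`.
-/

open scoped BigOperators DirectSum TensorProduct

namespace ZhuPf

open LaurentPolynomial

/-! ### Binomial coefficients -/

theorem qchoose_eq (m : ℤ) (n : ℕ) : qchoose (m : ℚ) n = ((Ring.choose m n : ℤ) : ℚ) := by
  have key : ∀ n : ℕ, ((n : ℚ) + 1) * ((Ring.choose m (n+1) : ℤ) : ℚ)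
      = ((Ring.choose m n : ℤ) : ℚ) * (m - n) := by
    intro n
    have h1 := Ring.descPochhammer_eq_factorial_smul_choose m (n+1)
    have h2 := Ring.descPochhammer_eq_factorial_smul_choose m n
    rw [descPochhammer_succ_right, Polynomial.smeval_mul, h2] at h1
    have h3 : Polynomial.smeval (Polynomial.X - (n : Polynomial ℤ)) m = m - n := by
      rw [Polynomial.smeval_sub, Polynomial.smeval_X, Polynomial.smeval_natCast]
      simp
    rw [h3, Nat.factorial_succ] at h1
    have h4 : (n.factorial : ℚ) ≠ 0 := by exact_mod_cast n.factorial_ne_zero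
    have h5 := congrArg (fun z : ℤ => (z : ℚ)) h1
    simp only [nsmul_eq_mul] at h5
    push_cast at h5
    apply mul_left_cancel₀ h4
    linarith
  induction n with
  | zero => simp [qchoose]
  | succ n ih =>
    rw [qchoose, ih, ← key n]
    field_simp

theorem zchoose_eq (m : ℤ) (n : ℕ) : zchoose m n = ((Ring.choose m n : ℤ) : ℂ) := by
  rw [zchoose, qchoose_eq]; simp

@[simp] theorem zchoose_zero (m : ℤ) : zchoose m 0 = 1 := by simp [zchoose_eq]

theorem zchoose_nat (k n : ℕ) : zchoose (k : ℤ) n = (k.choose n : ℂ) := by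
  rw [zchoose_eq]
  have := Ring.choose_natCast (R := ℤ) k n
  rw [this]; simp

theorem zchoose_one (m : ℤ) : zchoose m 1 = m := by
  rw [zchoose_eq, Ring.choose_one_right]

theorem zchoose_zero_succ (i : ℕ) : zchoose 0 (i+1) = 0 := by
  rw [zchoose_eq, Ring.choose_zero_succ]; simp

theorem zchoose_pascal (m : ℤ) (i : ℕ) :
    zchoose (m+1) (i+1) = zchoose m i + zchoose m (i+1) := by
  simp [zchoose_eq, Ring.choose_succ_succ]

theorem zchoose_vandermonde (r s : ℤ) (n : ℕ) :
    zchoose (r + s) n = ∑ ij ∈ Finset.HasAntidiagonal.antidiagonal n, zchoose r ij.1 * zchoose s ij.2 := by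
  simp [zchoose_eq, Ring.add_choose_eq n (Commute.all r s)]

theorem zchoose_neg (r : ℤ) (n : ℕ) :
    zchoose (-r) n = (-1) ^ n * zchoose (r + n - 1) n := by
  simp only [zchoose_eq, Ring.choose_neg]
  rw [Units.smul_def]
  simp [Int.negOnePow_def]

theorem zchoose_neg_one (n : ℕ) : zchoose (-1) n = (-1) ^ n := by
  rw [zchoose_neg]
  have : (1 + (n:ℤ) - 1) = (n : ℤ) := by ring
  rw [this, zchoose_nat]; simp

theorem zchoose_succ_mul (m : ℤ) (n : ℕ) :
    ((n : ℂ) + 1) * zchoose m (n+1) = zchoose m n * (m - n) := by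
  simp only [zchoose, qchoose]
  have : ((n:ℂ) + 1) ≠ 0 := by exact_mod_cast Nat.succ_ne_zero n
  push_cast
  field_simp

/-! ### Linear maps out of Laurent polynomials -/

abbrev LP := LaurentPolynomial ℂ

/-- The linear map sending `T n` to `c n`. -/
noncomputable def lpMap {M : Type*} [AddCommGroup M] [Module ℂ M] (c : ℤ → M) : LP →ₗ[ℂ] M where
  toFun f := Finsupp.linearCombination ℂ c f.coeff
  map_add' f g := by simp
  map_smul' r f := by simp

@[simp] theorem lpMap_T {M : Type*} [AddCommGroup M] [Module ℂ M] (c : ℤ → M) (n : ℤ) :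
    lpMap c (T n) = c n := by
  show Finsupp.linearCombination ℂ c (Finsupp.single n 1) = c n
  simp

theorem lp_induct {p : LP → Prop} (f : LP) (hT : ∀ n, p (T n))
    (hadd : ∀ f g, p f → p g → p (f + g)) (hsmul : ∀ (c : ℂ) f, p f → p (c • f)) : p f := by
  induction f using LaurentPolynomial.induction_on' with
  | add p q hp hq => exact hadd _ _ hp hq
  | C_mul_T n a =>
    have : (LaurentPolynomial.C a * T n : LP) = a • T n := by
      rw [LaurentPolynomial.smul_eq_C_mul]
    rw [this]; exact hsmul _ _ (hT n)

/-- Hasse derivative. -/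
noncomputable def H (i : ℕ) : LP →ₗ[ℂ] LP := lpMap (fun m => zchoose m i • T (m - i))

theorem H_T (i : ℕ) (m : ℤ) : H i (T m) = zchoose m i • T (m - i) := by simp [H]

/-- Taylor expansion. -/
noncomputable def tau (f : LP) : PowerSeries LP := PowerSeries.mk (fun i => H i f)

theorem tau_add (f g : LP) : tau (f + g) = tau f + tau g := by
  ext i : 1; simp [tau]

theorem tau_T_mul (f : LP) : tau (T 1 * f) = (PowerSeries.C (T 1) + PowerSeries.X) * tau f := by
  refine lp_induct (p := fun f => tau (T 1 * f) = (PowerSeries.C (T 1) + PowerSeries.X) * tau f)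
    f ?_ ?_ ?_
  · intro m
    rw [← T_add]
    ext i : 1
    rw [add_mul, map_add, PowerSeries.coeff_C_mul]
    cases i with
    | zero =>
      rw [PowerSeries.coeff_zero_X_mul, add_zero]
      simp only [tau, PowerSeries.coeff_mk, H_T, zchoose_zero, one_smul, Nat.cast_zero, sub_zero]
      rw [T_add]
    | succ i =>
      rw [PowerSeries.coeff_succ_X_mul]
      simp only [tau, PowerSeries.coeff_mk, H_T]
      rw [add_comm 1 m, zchoose_pascal, mul_smul_comm, ← T_add, add_smul, add_comm]
      congr 2
      · congr 1; push_cast; ring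
      · congr 1; push_cast; ring
  · intro f g hf hg
    rw [mul_add, tau_add, hf, hg, tau_add, mul_add]
  · intro c f hf
    have h : ∀ g : LP, tau (c • g) = c • tau g := by
      intro g; ext i : 1; simp [tau]
    rw [mul_smul_comm, h, h, hf, mul_smul_comm]

theorem tau_one_add_pow_mul (k : ℕ) (f : LP) :
    tau ((1 + T 1) ^ k * f) = (PowerSeries.X + PowerSeries.C (1 + T 1)) ^ k * tau f := by
  induction k with
  | zero => simp
  | succ k ih =>
    rw [pow_succ', mul_assoc, add_mul, one_mul, tau_add, tau_T_mul, ih, pow_succ', map_add, map_one]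
    ring

theorem coeff_pow (k r : ℕ) :
    PowerSeries.coeff r ((PowerSeries.X + PowerSeries.C (1 + T 1 : LP)) ^ k)
      = (k.choose r : ℂ) • (1 + T 1 : LP) ^ (k - r) := by
  have : ((PowerSeries.X + PowerSeries.C (1 + T 1 : LP)) ^ k)
      = (((Polynomial.X + Polynomial.C (1 + T 1 : LP)) ^ k : Polynomial LP) : PowerSeries LP) := by
    simp
  rw [this, Polynomial.coeff_coe, Polynomial.coeff_X_add_C_pow, mul_comm, ← nsmul_eq_mul,
    Nat.cast_smul_eq_nsmul]

theorem H_one_add_pow (k i : ℕ) :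
    H i ((1 + T 1) ^ k) = (k.choose i : ℂ) • (1 + T 1 : LP) ^ (k - i) := by
  have h := tau_one_add_pow_mul k 1
  have h1 : tau (1 : LP) = 1 := by
    ext i : 1
    rw [← T_zero, tau, PowerSeries.coeff_mk, H_T]
    cases i with
    | zero => simp
    | succ i => rw [zchoose_zero_succ]; simp [PowerSeries.coeff_one]
  rw [h1, mul_one, mul_one] at h
  rw [← coeff_pow, ← h, tau, PowerSeries.coeff_mk]

theorem H_one_add_pow_mul (k i : ℕ) :
    H i ((1 + T 1) ^ k * T (-1)) = ∑ p ∈ Finset.HasAntidiagonal.antidiagonal i,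
      ((k.choose p.1 : ℂ) * (-1) ^ p.2) • ((1 + T 1 : LP) ^ (k - p.1) * T (-1 - p.2)) := by
  have h := congrArg (PowerSeries.coeff i) (tau_one_add_pow_mul k (T (-1)))
  rw [tau, PowerSeries.coeff_mk, PowerSeries.coeff_mul] at h
  rw [h]
  refine Finset.sum_congr rfl fun p _ => ?_
  rw [coeff_pow, tau, PowerSeries.coeff_mk, H_T, zchoose_neg_one, smul_mul_smul_comm]

end ZhuPf


namespace ZhuPf

open LaurentPolynomial

/-! ### Smeared modes -/

section general
variable {W : Type} [AddCommGroup W] [Module ℂ W] (B : VOA W)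

/-- `Yf B u f = Res f(z) Y(u,z)` for a Laurent polynomial `f`. -/
noncomputable def Yf : W →ₗ[ℂ] LP →ₗ[ℂ] Module.End ℂ W :=
  LinearMap.mk₂ ℂ (fun u f => lpMap (B.Y u) f)
    (by intro u v f
        refine lp_induct (p := fun f => lpMap (B.Y (u+v)) f = lpMap (B.Y u) f + lpMap (B.Y v) f)
          f ?_ ?_ ?_
        · intro n; simp
        · intro f g hf hg; simp only [map_add] at *; rw [hf, hg]; abel
        · intro c f hf; simp only [map_smul] at *; rw [hf, smul_add])
    (by intro r u f
        refine lp_induct (p := fun f => lpMap (B.Y (r • u)) f = r • lpMap (B.Y u) f)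
          f ?_ ?_ ?_
        · intro n; simp
        · intro f g hf hg; simp only [map_add] at *; rw [hf, hg, smul_add]
        · intro c f hf; simp only [map_smul] at *; rw [hf, smul_comm])
    (by intro u f g; simp)
    (by intro r u f; simp)

@[simp] theorem Yf_T (u : W) (n : ℤ) : Yf B u (T n) = B.Y u n := by simp [Yf]

/-- `(1+z)^k z^s`. -/
noncomputable def zp (k : ℕ) (s : ℤ) : LP := (1 + T 1) ^ k * T s

theorem zp_succ (k : ℕ) (s : ℤ) : zp (k+1) s = zp k s + zp k (s+1) := by
  rw [zp, zp, zp, add_comm s 1, T_add, pow_succ]; ring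

theorem zp_mul (k l : ℕ) (s t : ℤ) : zp k s * zp l t = zp (k+l) (s+t) := by
  rw [zp, zp, zp, T_add, pow_add]; ring

theorem zp_eq_sum (k : ℕ) (s : ℤ) :
    zp k s = ∑ i ∈ Finset.range (k+1), (k.choose i : ℂ) • (T (s + i) : LP) := by
  rw [zp, add_comm (1 : LP), add_pow, Finset.sum_mul]
  refine Finset.sum_congr rfl fun i _ => ?_
  rw [T_pow, T_add, one_pow, Nat.cast_smul_eq_nsmul, nsmul_eq_mul, mul_one, mul_one]
  ring

theorem Yf_zp (u : W) (k : ℕ) (s : ℤ) (w : W) :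
    Yf B u (zp k s) w = ∑ i ∈ Finset.range (k+1), (k.choose i : ℂ) • B.Y u (s + i) w := by
  rw [zp_eq_sum]; simp [LinearMap.sum_apply]

theorem finsum_zchoose (k : ℕ) (g : ℕ → W) :
    ∑ᶠ i : ℕ, zchoose (k : ℤ) i • g i = ∑ i ∈ Finset.range (k+1), (k.choose i : ℂ) • g i := by
  simp only [zchoose_nat]
  apply finsum_eq_sum_of_support_subset
  intro i hi
  simp only [Finset.coe_range, Set.mem_Iio]
  by_contra h
  apply hi
  show (k.choose i : ℂ) • g i = 0
  rw [Nat.choose_eq_zero_of_lt (by omega)]; simp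

theorem mulAux_eq (k : ℕ) (u v : W) : B.mulAux k u v = Yf B u (zp k (-1)) v := by
  rw [VOA.mulAux, finsum_zchoose k (fun i => B.Y u ((i:ℤ)-1) v), Yf_zp]
  refine Finset.sum_congr rfl fun i _ => ?_
  rw [show (i:ℤ) - 1 = -1 + i by ring]

theorem circAux_eq (k : ℕ) (u v : W) : B.circAux k u v = Yf B u (zp k (-2)) v := by
  rw [VOA.circAux, finsum_zchoose k (fun i => B.Y u ((i:ℤ)-2) v), Yf_zp]
  refine Finset.sum_congr rfl fun i _ => ?_
  rw [show (i:ℤ) - 2 = -2 + i by ring]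

theorem exists_bound (u v : W) : ∃ N : ℕ, ∀ i : ℕ, N ≤ i → B.Y u i v = 0 := by
  obtain ⟨N, hN⟩ := B.trunc u v
  exact ⟨N.toNat, fun i hi => hN _ (by omega)⟩

/-- The commutator formula for modes. -/
theorem comm_modes (u v w : W) (N : ℕ) (hN : ∀ i : ℕ, N ≤ i → B.Y u i v = 0) (m n : ℤ) :
    B.Y u m (B.Y v n w) - B.Y v n (B.Y u m w)
      = ∑ i ∈ Finset.range N, zchoose m i • B.Y (B.Y u i v) (m + n - i) w := by
  have h := B.borcherds u v w 0 m n
  rw [finsum_eq_sum_of_support_subset (s := Finset.range N), finsum_eq_single _ 0] at h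
  · simpa using h.symm
  · intro i hi
    obtain ⟨j, rfl⟩ := Nat.exists_eq_succ_of_ne_zero hi
    rw [Nat.succ_eq_add_one, zchoose_zero_succ]; simp
  · intro i hi
    simp only [Finset.coe_range, Set.mem_Iio]
    by_contra h
    apply hi
    show zchoose m i • B.Y (B.Y u (0 + i) v) (m + n - i) w = 0
    rw [zero_add, hN i (by omega)]; simp

theorem comm_Yf (u v w : W) (N : ℕ) (hN : ∀ i : ℕ, N ≤ i → B.Y u i v = 0) (f g : LP) :
    Yf B u f (Yf B v g w) - Yf B v g (Yf B u f w)
      = ∑ i ∈ Finset.range N, Yf B (B.Y u i v) (H i f * g) w := by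
  refine lp_induct (p := fun f => Yf B u f (Yf B v g w) - Yf B v g (Yf B u f w)
      = ∑ i ∈ Finset.range N, Yf B (B.Y u i v) (H i f * g) w) f ?_ ?_ ?_
  · intro m
    refine lp_induct (p := fun g => Yf B u (T m) (Yf B v g w) - Yf B v g (Yf B u (T m) w)
      = ∑ i ∈ Finset.range N, Yf B (B.Y u i v) (H i (T m) * g) w) g ?_ ?_ ?_
    · intro n
      simp only [Yf_T]
      rw [comm_modes B u v w N hN]
      refine Finset.sum_congr rfl fun i _ => ?_
      rw [H_T, smul_mul_assoc, ← T_add, map_smul, Yf_T, show m - i + n = m + n - i by ring]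
      rfl
    · intro f g hf hg
      simp only [map_add, LinearMap.add_apply, mul_add, Finset.sum_add_distrib] at *
      rw [← hf, ← hg]; abel
    · intro c f hf
      simp only [map_smul, LinearMap.smul_apply, mul_smul_comm, ← Finset.smul_sum] at *
      rw [← hf, smul_sub]
  · intro f g hf hg
    simp only [map_add, LinearMap.add_apply, add_mul, Finset.sum_add_distrib] at *
    rw [← hf, ← hg]; abel
  · intro c f hf
    simp only [map_smul, LinearMap.smul_apply, smul_mul_assoc, ← Finset.smul_sum] at *
    rw [← hf, smul_sub]

theorem Yf_trans (u : W) (f : LP) : Yf B (B.Y B.omega 0 u) f = - Yf B u (H 1 f) := by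
  refine lp_induct (p := fun f => Yf B (B.Y B.omega 0 u) f = - Yf B u (H 1 f)) f ?_ ?_ ?_
  · intro n
    rw [Yf_T, B.translation, H_T, zchoose_one, map_smul, Yf_T, neg_smul]; rfl
  · intro f g hf hg
    simp only [map_add] at *; rw [hf, hg]; abel
  · intro c f hf
    simp only [map_smul] at *; rw [hf, smul_neg]

theorem H_one_zp (k : ℕ) (s : ℤ) :
    H 1 (zp (k+1) s) = ((k : ℂ) + 1 + s) • zp k s + (s : ℂ) • zp k (s-1) := by
  have h := congrArg (PowerSeries.coeff 1) (tau_one_add_pow_mul (k+1) (T s))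
  rw [tau, PowerSeries.coeff_mk, PowerSeries.coeff_mul] at h
  rw [zp, h, Finset.Nat.antidiagonal_succ]
  simp only [Finset.Nat.antidiagonal_zero, Finset.map_singleton, Finset.sum_cons, Finset.sum_singleton]
  simp only [coeff_pow, tau, PowerSeries.coeff_mk, H_T]
  have e := zp_succ k (s - 1)
  rw [sub_add_cancel] at e
  simp only [zp] at e ⊢
  simp [zchoose_one]
  rw [e]
  module

theorem mem_O (k : ℕ) (u v : W) (hu : u ∈ B.wt k) (s : ℕ) :
    Yf B u (zp k (-(s+2 : ℕ))) v ∈ B.Osub := by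
  induction s generalizing k u with
  | zero =>
    apply Submodule.subset_span
    exact ⟨k, u, v, hu, by rw [circAux_eq]; rfl⟩
  | succ s ih =>
    have h1 : B.Y B.omega 0 u ∈ B.wt ((k+1 : ℕ) : ℤ) := by
      have := B.mode_wt 2 _ B.omega_wt k 0 u hu
      convert this using 2; push_cast; ring
    have h2 := ih (k+1) _ h1
    rw [Yf_trans, H_one_zp] at h2
    have h3 := ih k u hu
    have h4 : (((-(s+2:ℕ) : ℤ)) : ℂ) ≠ 0 := by
      push_cast
      intro h
      have : ((s:ℂ) + 2) = 0 := by linear_combination -h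
      exact absurd this (by exact_mod_cast (by omega : s + 2 ≠ 0))
    simp only [map_add, map_smul, LinearMap.neg_apply, LinearMap.add_apply,
      LinearMap.smul_apply] at h2
    rw [Submodule.neg_mem_iff, Submodule.add_mem_iff_right _ (Submodule.smul_mem _ _ h3),
      Submodule.smul_mem_iff _ h4] at h2
    convert h2 using 4; push_cast; ring

theorem mem_O2 (k : ℕ) (u v : W) (hu : u ∈ B.wt k) (a s : ℕ) :
    Yf B u (zp (k + a) (-(a + s+2 : ℕ))) v ∈ B.Osub := by
  induction a generalizing s with
  | zero => simpa using mem_O B k u v hu s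
  | succ a ih =>
    rw [← add_assoc, zp_succ, map_add, LinearMap.add_apply]
    refine Submodule.add_mem _ ?_ ?_
    · convert ih (s+1) using 5; push_cast; ring
    · convert ih s using 5; push_cast; ring

theorem mem_O1 (k : ℕ) (u v : W) (hu : u ∈ B.wt k) (a : ℕ) :
    Yf B u (zp (k + a) (-(a + 1 : ℕ))) v - Yf B u (zp k (-1)) v ∈ B.Osub := by
  induction a with
  | zero => simp
  | succ a ih =>
    rw [← add_assoc, zp_succ, map_add, LinearMap.add_apply, add_sub_assoc]
    refine Submodule.add_mem _ ?_ ?_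
    · convert mem_O2 B k u v hu a 0 using 5
    · convert ih using 6; push_cast; ring

/-- Positivity of the grading, with one dimensional weight zero space. -/
structure CFT : Prop where
  neg : ∀ k : ℤ, k < 0 → B.wt k = ⊥
  zero : ∀ x ∈ B.wt 0, ∃ c : ℂ, x = c • B.one

/-- Zhu product as a bilinear map. -/
noncomputable def Lm : W →ₗ[ℂ] Module.End ℂ W :=
  (DirectSum.toModule ℂ ℤ (Module.End ℂ W)
    (fun k => ((Yf B).flip (zp k.toNat (-1))).comp (B.wt k).subtype)) ∘ₗ B.decompose.toLinearMap

theorem decompose_mem (k : ℤ) (u : W) (hu : u ∈ B.wt k) :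
    B.decompose u = DirectSum.lof ℂ ℤ (fun k => B.wt k) k ⟨u, hu⟩ := by
  rw [VOA.decompose, LinearEquiv.symm_apply_eq]
  exact (DirectSum.coeLinearMap_lof B.wt k ⟨u, hu⟩).symm

theorem Lm_wt (k : ℕ) (u : W) (hu : u ∈ B.wt k) : Lm B u = Yf B u (zp k (-1)) := by
  simp only [Lm, LinearMap.comp_apply, LinearEquiv.coe_coe]
  rw [decompose_mem B k u hu, DirectSum.toModule_lof]
  simp

theorem hcomp_mem (k : ℤ) (u : W) : B.hcomp k u ∈ B.wt k := (B.decompose u k).2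

theorem hcomp_finite (u : W) : (Function.support fun k => B.hcomp k u).Finite := by
  classical
  refine (DFinsupp.support (B.decompose u)).finite_toSet.subset ?_
  intro k hk
  simp only [Finset.mem_coe, DFinsupp.mem_support_toFun]
  intro h
  apply hk
  show ((B.decompose u k : B.wt k) : W) = 0
  have h' : B.decompose u k = 0 := h
  rw [h']; rfl

theorem finsum_hcomp (u : W) : ∑ᶠ k, B.hcomp k u = u := by
  classical
  have h : DirectSum.coeLinearMap B.wt (B.decompose u) = u :=
    (LinearEquiv.ofBijective (DirectSum.coeLinearMap B.wt) B.internal).apply_symm_apply u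
  conv_rhs => rw [← h]
  rw [DirectSum.coeLinearMap_eq_dfinsuppSum, DFinsupp.sum]
  apply finsum_eq_sum_of_support_subset
  intro k hk
  simp only [Finset.mem_coe, DFinsupp.mem_support_toFun]
  intro h
  apply hk
  show ((B.decompose u k : B.wt k) : W) = 0
  have h' : B.decompose u k = 0 := h
  rw [h']; rfl

variable {B}

theorem star_eq (hB : CFT B) (u v : W) : B.star u v = Lm B u v := by
  rw [VOA.star]
  have h1 : ∀ k : ℤ, B.mulAux k (B.hcomp k u) v = (Lm B).flip v (B.hcomp k u) := by
    intro k
    by_cases hk : 0 ≤ k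
    · lift k to ℕ using hk
      rw [mulAux_eq, LinearMap.flip_apply, Lm_wt B k _ (hcomp_mem B k u)]
    · have h := hcomp_mem B k u
      rw [hB.neg k (by omega), Submodule.mem_bot] at h
      rw [h]; simp [VOA.mulAux]
  simp only [h1]
  have h2 := AddMonoidHom.map_finsum ((Lm B).flip v).toAddMonoidHom (hcomp_finite B u)
  rw [finsum_hcomp] at h2
  exact h2.symm

theorem hom_top (hB : CFT B) (U : Submodule ℂ W) (h : ∀ k : ℕ, ∀ x ∈ B.wt k, x ∈ U) (x : W) :
    x ∈ U := by
  rw [← finsum_hcomp B x]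
  refine finsum_induction (fun x => x ∈ U) U.zero_mem (fun _ _ => U.add_mem) ?_
  intro k
  by_cases hk : 0 ≤ k
  · lift k to ℕ using hk
    exact h k _ (hcomp_mem B k x)
  · have h := hcomp_mem B k x
    rw [hB.neg k (by omega), Submodule.mem_bot] at h
    rw [h]; exact U.zero_mem

theorem hom_top' (hB : CFT B) (U : Submodule ℂ W) (h1 : B.one ∈ U)
    (h : ∀ k : ℕ, ∀ x ∈ B.wt ((k+1 : ℕ) : ℤ), x ∈ U) (x : W) : x ∈ U := by
  refine hom_top hB U ?_ x
  intro k x hx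
  cases k with
  | zero =>
    obtain ⟨c, rfl⟩ := hB.zero x hx
    exact U.smul_mem _ h1
  | succ k => exact h k x hx

theorem O_le (hB : CFT B) (U : Submodule ℂ W)
    (h : ∀ (l : ℕ) (b c : W), b ∈ B.wt l → Yf B b (zp l (-2)) c ∈ U) : B.Osub ≤ U := by
  refine Submodule.span_le.2 ?_
  rintro w ⟨k, u, v, hu, rfl⟩
  by_cases hk : 0 ≤ k
  · lift k to ℕ using hk
    rw [circAux_eq]; exact h _ _ _ hu
  · rw [hB.neg k (by omega), Submodule.mem_bot] at hu
    rw [hu]; simp [VOA.circAux]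

end general

end ZhuPf


namespace ZhuPf

open LaurentPolynomial

section general
variable {W : Type} [AddCommGroup W] [Module ℂ W] {B : VOA W}

theorem mode_nat (hB : CFT B) {k l : ℕ} {y b : W} (hy : y ∈ B.wt k) (hb : b ∈ B.wt l) (i : ℕ) :
    B.Y y i b = 0 ∨ ∃ K : ℕ, K + 1 + i = k + l ∧ B.Y y i b ∈ B.wt K := by
  have h := B.mode_wt k y hy l i b hb
  by_cases hK : (l : ℤ) + k - i - 1 < 0
  · left; rwa [hB.neg _ hK, Submodule.mem_bot] at h
  · right
    refine ⟨k + l - 1 - i, by omega, ?_⟩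
    convert h using 2; omega

theorem term_O (hB : CFT B) {k l : ℕ} {y b : W} (hy : y ∈ B.wt k) (hb : b ∈ B.wt l) (i : ℕ)
    (s : ℕ) (c : W) :
    Yf B (B.Y y i b) (H i (zp k (-1)) * zp l (-(s+2 : ℕ))) c ∈ B.Osub := by
  rcases mode_nat hB hy hb i with h | ⟨K, hK, hx⟩
  · rw [h]; simp
  rw [zp, H_one_add_pow_mul, Finset.sum_mul, map_sum, LinearMap.sum_apply]
  refine Submodule.sum_mem _ fun p hp => ?_
  have hp' : p.1 + p.2 = i := by simpa using hp
  rw [smul_mul_assoc, map_smul, LinearMap.smul_apply]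
  by_cases hk : p.1 ≤ k
  · refine Submodule.smul_mem _ _ ?_
    have h := mem_O2 B K _ c hx (1 + p.2) s
    have e := zp_mul (k - p.1) l (-1 - p.2) (-(s+2:ℕ))
    rw [zp] at e
    rw [e, show k - p.1 + l = K + (1 + p.2) by omega,
      show (-1 - (p.2:ℤ) + -((s+2:ℕ):ℤ)) = -((1+p.2+s+2:ℕ):ℤ) by push_cast; ring]
    exact h
  · rw [Nat.choose_eq_zero_of_lt (by omega)]; simp

theorem term_L (hB : CFT B) {k l : ℕ} {y b : W} (hy : y ∈ B.wt k) (hb : b ∈ B.wt l) (i : ℕ)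
    (c : W) :
    Yf B (B.Y y i b) (H i (zp k (-1)) * zp l (-1)) c
      - zchoose ((k:ℤ) - 1) i • Lm B (B.Y y i b) c ∈ B.Osub := by
  rcases mode_nat hB hy hb i with h | ⟨K, hK, hx⟩
  · rw [h]; simp
  rw [zp, H_one_add_pow_mul, Finset.sum_mul, map_sum, LinearMap.sum_apply, sub_eq_add_neg (k:ℤ),
    zchoose_vandermonde, Finset.sum_smul, ← Finset.sum_sub_distrib]
  refine Submodule.sum_mem _ fun p hp => ?_
  have hp' : p.1 + p.2 = i := by simpa using hp
  rw [smul_mul_assoc, map_smul, LinearMap.smul_apply, zchoose_nat, zchoose_neg_one, ← smul_sub]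
  by_cases hk : p.1 ≤ k
  · refine Submodule.smul_mem _ _ ?_
    have h := mem_O1 B K _ c hx (1 + p.2)
    have e := zp_mul (k - p.1) l (-1 - p.2) (-1)
    rw [zp] at e
    rw [e, Lm_wt B K _ hx, show k - p.1 + l = K + (1 + p.2) by omega,
      show (-1 - (p.2:ℤ) + -1) = -((1+p.2+1:ℕ):ℤ) by push_cast; ring]
    exact h
  · rw [Nat.choose_eq_zero_of_lt (by omega)]; simp

/-- `O` is a left ideal. -/
theorem left_ideal (hB : CFT B) (y : W) {o : W} (ho : o ∈ B.Osub) : Lm B y o ∈ B.Osub := by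
  refine hom_top hB (B.Osub.comap ((Lm B).flip o)) ?_ y
  intro k y hy
  show Lm B y o ∈ B.Osub
  have h : B.Osub ≤ B.Osub.comap (Lm B y) := by
    refine O_le hB _ ?_
    intro l b c hb
    show Lm B y _ ∈ B.Osub
    rw [Lm_wt B k y hy]
    obtain ⟨N, hN⟩ := exists_bound B y b
    have e := comm_Yf B y b c N hN (zp k (-1)) (zp l (-2))
    rw [sub_eq_iff_eq_add] at e
    rw [e]
    refine Submodule.add_mem _ (Submodule.sum_mem _ fun i _ => ?_) ?_
    · have h := term_O hB hy hb i 0 c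
      rw [show (-((0+2:ℕ):ℤ)) = -2 by norm_num] at h
      exact h
    · have h := mem_O B l b (Yf B y (zp k (-1)) c) hb 0
      rw [show (-((0+2:ℕ):ℤ)) = -2 by norm_num] at h
      exact h
  exact h ho

/-- The inner derivation attached to `y` of weight `k+1`. -/
noncomputable def Dm (B : VOA W) (k : ℕ) (y : W) : Module.End ℂ W := Yf B y (zp k 0)

theorem H_zp0 (k i : ℕ) : H i (zp k 0) = (k.choose i : ℂ) • zp (k - i) 0 := by
  simp only [zp, T_zero, mul_one, H_one_add_pow]

theorem mem_O0 (k : ℕ) (u v : W) (hu : u ∈ B.wt k) : Yf B u (zp k (-2)) v ∈ B.Osub := by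
  have h := mem_O B k u v hu 0
  rw [show (-((0+2:ℕ):ℤ)) = -2 by norm_num] at h
  exact h

theorem D_term (hB : CFT B) (k l i : ℕ) (y b c : W) (hy : y ∈ B.wt ((k+1 : ℕ) : ℤ))
    (hb : b ∈ B.wt l) : Yf B (B.Y y i b) (H i (zp k 0) * zp l (-2)) c ∈ B.Osub := by
  rcases mode_nat hB hy hb i with h | ⟨K, hK, hx⟩
  · rw [h, map_zero]
    exact B.Osub.zero_mem
  rw [H_zp0, smul_mul_assoc, map_smul, LinearMap.smul_apply, zp_mul]
  by_cases hk : i ≤ k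
  · refine Submodule.smul_mem _ _ ?_
    have e1 : k - i + l = K := by omega
    have e2 : (0:ℤ) + -2 = -2 := by norm_num
    rw [e1, e2]
    exact mem_O0 K _ c hx
  · rw [Nat.choose_eq_zero_of_lt (by omega), Nat.cast_zero, zero_smul]
    exact B.Osub.zero_mem

theorem D_ideal (hB : CFT B) (k : ℕ) (y : W) (hy : y ∈ B.wt ((k+1 : ℕ) : ℤ)) {o : W}
    (ho : o ∈ B.Osub) : Dm B k y o ∈ B.Osub := by
  have h : B.Osub ≤ B.Osub.comap (Dm B k y) := by
    refine O_le hB _ ?_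
    intro l b c hb
    rw [Submodule.mem_comap]
    obtain ⟨N, hN⟩ := exists_bound B y b
    have e := comm_Yf B y b c N hN (zp k 0) (zp l (-2))
    rw [sub_eq_iff_eq_add] at e
    rw [Dm, e]
    refine Submodule.add_mem _ (Submodule.sum_mem _ fun i _ => ?_) ?_
    · exact D_term hB k l i y b c hy hb
    · exact mem_O0 l b _ hb
  exact h ho

theorem Dm_sum (k : ℕ) (y b : W) (N : ℕ) (hN : ∀ i : ℕ, N ≤ i → B.Y y i b = 0) :
    Dm B k y b = ∑ i ∈ Finset.range N, (k.choose i : ℂ) • B.Y y i b := by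
  rw [Dm, Yf_zp]
  simp only [zero_add]
  have h1 : ∑ i ∈ Finset.range (k+1), (k.choose i : ℂ) • B.Y y i b
      = ∑ i ∈ Finset.range (max N (k+1)), (k.choose i : ℂ) • B.Y y i b := by
    apply Finset.sum_subset (by intro i; simp; omega)
    intro i _ hi
    simp only [Finset.mem_range, not_lt] at hi
    rw [Nat.choose_eq_zero_of_lt (by omega)]; simp
  have h2 : ∑ i ∈ Finset.range N, (k.choose i : ℂ) • B.Y y i b
      = ∑ i ∈ Finset.range (max N (k+1)), (k.choose i : ℂ) • B.Y y i b := by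
    apply Finset.sum_subset (by intro i; simp; omega)
    intro i _ hi
    simp only [Finset.mem_range, not_lt] at hi
    rw [hN i hi]; simp
  rw [h1, h2]

theorem D_deriv (hB : CFT B) (k : ℕ) (y : W) (hy : y ∈ B.wt ((k+1 : ℕ) : ℤ)) (b c : W) :
    Dm B k y (Lm B b c) = Lm B (Dm B k y b) c + Lm B b (Dm B k y c) := by
  have h : b ∈ (LinearMap.ker (Dm B k y ∘ₗ (Lm B).flip c - (Lm B).flip c ∘ₗ Dm B k y
      - (Lm B).flip (Dm B k y c))) := by
    refine hom_top hB _ ?_ b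
    intro l b hb
    rw [LinearMap.mem_ker]
    simp only [LinearMap.sub_apply, LinearMap.comp_apply, LinearMap.flip_apply]
    obtain ⟨N, hN⟩ := exists_bound B y b
    have e := comm_Yf B y b c N hN (zp k 0) (zp l (-1))
    rw [Dm_sum k y b N hN, Lm_wt B l b hb, map_sum, LinearMap.sum_apply, sub_right_comm]
    rw [Dm, e, sub_eq_zero]
    refine Finset.sum_congr rfl fun i _ => ?_
    rcases mode_nat hB hy hb i with h | ⟨K, hK, hx⟩
    · rw [h]; simp
    rw [H_zp0, smul_mul_assoc, map_smul, LinearMap.smul_apply, zp_mul, map_smul,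
      LinearMap.smul_apply]
    by_cases hk : i ≤ k
    · rw [Lm_wt B K _ hx, zero_add, show k - i + l = K by omega]
    · rw [Nat.choose_eq_zero_of_lt (by omega)]; simp
  rw [LinearMap.mem_ker] at h
  simp only [LinearMap.sub_apply, LinearMap.comp_apply, LinearMap.flip_apply] at h
  rw [sub_sub, sub_eq_zero] at h
  exact h

theorem L_comm (hB : CFT B) (k : ℕ) (y : W) (hy : y ∈ B.wt ((k+1 : ℕ) : ℤ)) (b c : W) :
    Lm B y (Lm B b c) - Lm B b (Lm B y c) - Lm B (Dm B k y b) c ∈ B.Osub := by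
  have h : b ∈ (B.Osub.comap (Lm B y ∘ₗ (Lm B).flip c - (Lm B).flip (Lm B y c)
      - (Lm B).flip c ∘ₗ Dm B k y)) := by
    refine hom_top hB _ ?_ b
    intro l b hb
    show Lm B y (Lm B b c) - Lm B b (Lm B y c) - Lm B (Dm B k y b) c ∈ B.Osub
    obtain ⟨N, hN⟩ := exists_bound B y b
    have e := comm_Yf B y b c N hN (zp (k+1) (-1)) (zp l (-1))
    rw [Dm_sum k y b N hN, Lm_wt B l b hb, Lm_wt B _ y hy, e, map_sum, LinearMap.sum_apply,
      ← Finset.sum_sub_distrib]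
    refine Submodule.sum_mem _ fun i _ => ?_
    have h := term_L hB hy hb i c
    rw [show (((k+1:ℕ):ℤ) - 1) = (k:ℤ) by push_cast; ring, zchoose_nat] at h
    rw [map_smul, LinearMap.smul_apply]
    exact h
  exact h

/-! ### Skew symmetry modulo `O` -/

theorem skew (u v : W) (N : ℕ) (p : ℤ) (hN : ∀ i : ℕ, N ≤ i → B.Y u (p + i) v = 0) :
    B.Y v p u = ∑ i ∈ Finset.range N,
      ((-1 : ℂ) ^ p * (-1) ^ (i+1)) • B.Y (B.Y u (p + i) v) (-1 - i) B.one := by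
  have h := B.borcherds u v B.one p (-1) 0
  rw [finsum_eq_sum_of_support_subset (s := Finset.range N), finsum_eq_single _ 0] at h
  · simp only [zchoose_neg_one] at h
    have h0 : B.Y v (0 + ((0:ℕ):ℤ)) B.one = 0 := B.create_ge v _ (by simp)
    rw [h0] at h
    simp only [Nat.cast_zero, add_zero, sub_zero, zero_add, map_zero, pow_zero, zchoose_zero,
      one_mul, one_smul, zero_sub, B.create u] at h
    have h2 : B.Y v p u = (-(-1 : ℂ)^p) • -((-1 : ℂ)^p • B.Y v p u) := by
      rw [smul_neg, neg_smul, neg_neg, smul_smul, ← mul_zpow]; simp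
    rw [h2, ← h, Finset.smul_sum]
    refine Finset.sum_congr rfl fun i _ => ?_
    rw [smul_smul]
    congr 1
    ring
  · intro i hi
    have h1 : B.Y v (0 + (i:ℤ)) B.one = 0 := B.create_ge v _ (by omega)
    have h2 : B.Y u (-1 + (i:ℤ)) B.one = 0 := B.create_ge u _ (by omega)
    rw [h1, h2]; simp
  · intro i hi
    simp only [Finset.coe_range, Set.mem_Iio]
    by_contra h
    apply hi
    show zchoose (-1) i • B.Y (B.Y u (p + i) v) (-1 + 0 - i) B.one = 0
    rw [hN i (by omega)]; simp

theorem vac_O (m : ℕ) (x : W) (hx : x ∈ B.wt m) (i : ℕ) :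
    B.Y x (-1 - i) B.one - zchoose (-m) i • x ∈ B.Osub := by
  induction i using Nat.strong_induction_on with
  | _ i ih =>
  cases i with
  | zero => simp [B.create]
  | succ n =>
    have h := mem_O B m x B.one hx n
    have h1 : Yf B x (zp m (-(n+2:ℕ))) B.one = ∑ p ∈ Finset.HasAntidiagonal.antidiagonal (n+1),
        zchoose m p.1 • B.Y x (-1 - p.2) B.one := by
      rw [Yf_zp, Finset.Nat.sum_antidiagonal_eq_sum_range_succ_mk]
      have h1 : ∀ (a : ℕ), a = m + 1 ∨ a = n + 2 →
        ∑ i ∈ Finset.range a, (m.choose i : ℂ) • B.Y x (-(n+2:ℕ) + i) B.one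
        = ∑ i ∈ Finset.range (max (m+1) (n+2)), (m.choose i : ℂ) • B.Y x (-(n+2:ℕ) + i) B.one := by
        intro a ha
        apply Finset.sum_subset (by intro i; simp; omega)
        intro i _ hi
        simp only [Finset.mem_range, not_lt] at hi
        rcases ha with ha | ha
        · rw [Nat.choose_eq_zero_of_lt (by omega)]; simp
        · rw [B.create_ge x _ (by omega)]; simp
      rw [h1 _ (Or.inl rfl), ← h1 _ (Or.inr rfl)]
      refine Finset.sum_congr rfl fun i hi => ?_
      simp only [Finset.mem_range] at hi
      simp only [zchoose_nat]
      congr 3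
      push_cast [Nat.cast_sub (show i ≤ n + 1 by omega)]
      ring
    have h2 : ∑ p ∈ Finset.HasAntidiagonal.antidiagonal (n+1),
        zchoose m p.1 • zchoose (-m) p.2 • x = 0 := by
      have := zchoose_vandermonde m (-m) (n+1)
      rw [add_neg_cancel, zchoose_zero_succ] at this
      simp only [smul_smul]
      rw [← Finset.sum_smul, ← this, zero_smul]
    rw [h1] at h
    have h3 : ∑ p ∈ Finset.HasAntidiagonal.antidiagonal (n+1),
        zchoose m p.1 • (B.Y x (-1 - p.2) B.one - zchoose (-m) p.2 • x) ∈ B.Osub := by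
      simp only [smul_sub, Finset.sum_sub_distrib]
      rw [h2, sub_zero]; exact h
    rw [Finset.Nat.antidiagonal_succ, Finset.sum_cons] at h3
    rw [Submodule.add_mem_iff_left] at h3
    · simpa using h3
    · refine Submodule.sum_mem _ fun p hp => Submodule.smul_mem _ _ ?_
      simp only [Finset.mem_map] at hp
      obtain ⟨q, hq, rfl⟩ := hp
      have hq' : q.1 + q.2 = n := by simpa using hq
      exact ih q.2 (by omega)

end general
end ZhuPf


namespace ZhuPf

open LaurentPolynomial

section general
variable {W : Type} [AddCommGroup W] [Module ℂ W] {B : VOA W}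

theorem sum_square {G : Type} [AddCommMonoid G] (M : ℕ) (f : ℕ → ℕ → G)
    (h : ∀ j i, M ≤ j + i → f j i = 0) :
    ∑ j ∈ Finset.range M, ∑ i ∈ Finset.range M, f j i
      = ∑ n ∈ Finset.range M, ∑ p ∈ Finset.HasAntidiagonal.antidiagonal n, f p.1 p.2 := by
  rw [← Finset.sum_product']
  rw [← Finset.sum_filter_of_ne (p := fun p : ℕ × ℕ => p.1 + p.2 < M)]
  · rw [← Finset.sum_fiberwise_of_maps_to (t := Finset.range M) (g := fun p : ℕ × ℕ => p.1 + p.2)]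
    · refine Finset.sum_congr rfl fun n hn => ?_
      refine Finset.sum_congr ?_ fun _ _ => rfl
      ext p
      simp only [Finset.mem_range] at hn
      simp only [Finset.mem_filter, Finset.mem_product, Finset.mem_range,
        Finset.HasAntidiagonal.mem_antidiagonal]
      omega
    · intro p hp
      simp only [Finset.mem_filter] at hp
      simp only [Finset.mem_range]
      exact hp.2
  · intro p _ hp
    by_contra hc
    exact hp (h _ _ (by omega))

theorem Yf_zp_M (u : W) (k : ℕ) (s : ℤ) (w : W) (M : ℕ) (hM : k + 1 ≤ M) :
    Yf B u (zp k s) w = ∑ i ∈ Finset.range M, (k.choose i : ℂ) • B.Y u (s + i) w := by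
  rw [Yf_zp]
  apply Finset.sum_subset (by intro i; simp; omega)
  intro i _ hi
  simp only [Finset.mem_range, not_lt] at hi
  rw [Nat.choose_eq_zero_of_lt (by omega)]; simp

theorem vac_O' (hB : CFT B) (m : ℤ) (x : W) (hx : x ∈ B.wt m) (i : ℕ) :
    B.Y x (-1 - i) B.one - zchoose (-m) i • x ∈ B.Osub := by
  by_cases hm : 0 ≤ m
  · lift m to ℕ using hm
    exact vac_O m x hx i
  · rw [hB.neg m (by omega), Submodule.mem_bot] at hx
    rw [hx]; simp

theorem neg_one_comb (n : ℕ) (k : ℕ) :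
    (-1 : ℂ) ^ n * zchoose ((n:ℤ) - (k + 1 : ℕ)) n = (k.choose n : ℂ) := by
  have h := zchoose_neg k n
  have e : ((n:ℤ) - (k+1:ℕ)) = -((k:ℤ) - n + 1) := by push_cast; ring
  rw [e, zchoose_neg, ← mul_assoc, ← mul_pow]
  rw [show (k:ℤ) - n + 1 + n - 1 = k by ring, zchoose_nat]
  simp

theorem comm_hom (hB : CFT B) (k l : ℕ) (u v : W) (hu : u ∈ B.wt ((k+1 : ℕ) : ℤ))
    (hv : v ∈ B.wt l) : Lm B v u - Yf B u (zp k (-1)) v ∈ B.Osub := by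
  obtain ⟨N, hN⟩ := exists_bound B u v
  set M := N + l + k + 2 with hM
  rw [Lm_wt B l v hv, Yf_zp_M v l (-1) u M (by omega), Yf_zp_M u k (-1) v M (by omega)]
  have hx : ∀ n : ℕ, B.Y u (-1 + n) v ∈ B.wt (-((n:ℤ) - (k+1:ℕ) - l)) := by
    intro n
    have := B.mode_wt _ u hu l (-1 + n) v hv
    convert this using 2; push_cast; ring
  have hs : ∀ j : ℕ, B.Y v (-1 + j) u - ∑ i ∈ Finset.range M,
      ((-1:ℂ) ^ (j + i) * zchoose (((j + i : ℕ):ℤ) - (k+1:ℕ) - l) i) • B.Y u (-1 + (j+i:ℕ)) v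
      ∈ B.Osub := by
    intro j
    rw [skew u v M (-1 + j) (fun i hi => by
      have := hN (i + j - 1) (by omega)
      convert this using 3; omega), ← Finset.sum_sub_distrib]
    refine Submodule.sum_mem _ fun i _ => ?_
    have h := vac_O' hB _ _ (hx (j+i)) i
    have h2 := Submodule.smul_mem _ ((-1:ℂ)^(j+i)) h
    rw [smul_sub, smul_smul] at h2
    rw [neg_neg] at h2
    rw [show (-1 + (j:ℤ) + i) = -1 + ((j+i:ℕ):ℤ) by push_cast; ring]
    rw [show ((-1:ℂ) ^ (-1 + (j:ℤ)) * (-1)^(i+1)) = (-1)^(j+i) by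
      rw [zpow_add₀ (by norm_num), zpow_natCast, pow_succ, pow_add]; norm_num]
    exact h2
  have hs2 : ∑ j ∈ Finset.range M, (l.choose j : ℂ) • ∑ i ∈ Finset.range M,
      ((-1:ℂ) ^ (j + i) * zchoose (((j + i : ℕ):ℤ) - (k+1:ℕ) - l) i) • B.Y u (-1 + (j+i:ℕ)) v
      = ∑ n ∈ Finset.range M, (k.choose n : ℂ) • B.Y u (-1 + n) v := by
    simp only [Finset.smul_sum, smul_smul]
    rw [sum_square M (fun j i => ((l.choose j : ℂ) *
      ((-1:ℂ) ^ (j + i) * zchoose (((j + i : ℕ):ℤ) - (k+1:ℕ) - l) i)) • B.Y u (-1 + (j+i:ℕ)) v)]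
    · refine Finset.sum_congr rfl fun n _ => ?_
      have h3 := zchoose_vandermonde l ((n:ℤ) - (k+1:ℕ) - l) n
      rw [show (l:ℤ) + ((n:ℤ) - (k+1:ℕ) - l) = n - (k+1:ℕ) by ring] at h3
      rw [← neg_one_comb n k, h3, Finset.mul_sum, Finset.sum_smul]
      refine Finset.sum_congr rfl fun p hp => ?_
      have hp' : p.1 + p.2 = n := by simpa using hp
      rw [hp', zchoose_nat]
      congr 1
      ring
    · intro j i hji
      have := hN (j + i - 1) (by omega)
      rw [show (-1 + ((j+i:ℕ):ℤ)) = ((j+i-1:ℕ):ℤ) by omega, this, smul_zero]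
  rw [← hs2, ← Finset.sum_sub_distrib]
  refine Submodule.sum_mem _ fun j _ => ?_
  rw [← smul_sub]
  exact Submodule.smul_mem _ _ (hs j)

/-- Commutators in the Zhu algebra. -/
theorem comm_O (hB : CFT B) (k : ℕ) (u v : W) (hu : u ∈ B.wt ((k+1 : ℕ) : ℤ)) :
    Lm B u v - Lm B v u - Dm B k u v ∈ B.Osub := by
  have h : v ∈ B.Osub.comap (Lm B u - (Lm B).flip u - Dm B k u) := by
    refine hom_top hB _ ?_ v
    intro l v hv
    show Lm B u v - Lm B v u - Dm B k u v ∈ B.Osub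
    have h := comm_hom hB k l u v hu hv
    have e : Lm B u v = Yf B u (zp k (-1)) v + Dm B k u v := by
      rw [Lm_wt B _ u hu, zp_succ, map_add, LinearMap.add_apply, Dm]
      norm_num
    rw [e, ← Submodule.neg_mem_iff]
    convert h using 1
    abel
  exact h

theorem Lm_one (x : W) : Lm B B.one x = x := by
  have h : B.one ∈ B.wt ((0:ℕ):ℤ) := B.one_wt
  rw [Lm_wt B 0 _ h, Yf_zp]
  simp [B.vacuum_act]

theorem Lm_right_one (hB : CFT B) (x : W) : Lm B x B.one = x := by
  have h : x ∈ LinearMap.ker ((Lm B).flip B.one - LinearMap.id) := by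
    refine hom_top hB _ ?_ x
    intro k x hx
    rw [LinearMap.mem_ker]
    simp only [LinearMap.sub_apply, LinearMap.flip_apply, LinearMap.id_apply]
    rw [Lm_wt B k x hx, Yf_zp, Finset.sum_range_succ', Finset.sum_eq_zero]
    · simp [B.create]
    · intro i _
      rw [B.create_ge x _ (by push_cast; omega), smul_zero]
  rw [LinearMap.mem_ker] at h
  simpa [sub_eq_zero] using h

theorem right_ideal (hB : CFT B) (y : W) {o : W} (ho : o ∈ B.Osub) : Lm B o y ∈ B.Osub := by
  have h : y ∈ B.Osub.comap (Lm B o) := by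
    refine hom_top' hB _ ?_ ?_ y
    · show Lm B o B.one ∈ B.Osub
      rw [Lm_right_one hB]; exact ho
    · intro k y hy
      show Lm B o y ∈ B.Osub
      have h1 := comm_O hB k y o hy
      have h2 := left_ideal hB y ho
      have h3 := D_ideal hB k y hy ho
      have := Submodule.sub_mem _ (Submodule.sub_mem _ h2 h3) h1
      convert this using 1
      abel
  exact h

theorem assoc (hB : CFT B) (a b y : W) :
    Lm B (Lm B a b) y - Lm B a (Lm B b y) ∈ B.Osub := by
  have h : y ∈ B.Osub.comap (Lm B (Lm B a b) - Lm B a ∘ₗ Lm B b) := by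
    refine hom_top' hB _ ?_ ?_ y
    · show Lm B (Lm B a b) B.one - Lm B a (Lm B b B.one) ∈ B.Osub
      simp [Lm_right_one hB]
    · intro k y hy
      show Lm B (Lm B a b) y - Lm B a (Lm B b y) ∈ B.Osub
      have h1 := comm_O hB k y (Lm B a b) hy
      rw [D_deriv hB k y hy a b] at h1
      have h2 := L_comm hB k y hy a b
      have h3 := left_ideal hB a (comm_O hB k y b hy)
      rw [map_sub, map_sub] at h3
      have := Submodule.add_mem _ (Submodule.sub_mem _ h2 h1) h3
      convert this using 1
      abel
  exact h

/-- Elements commuting with `x` modulo `O` are closed under the product. -/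
theorem comm_mul (hB : CFT B) (x a b : W) (ha : Lm B x a - Lm B a x ∈ B.Osub)
    (hb : Lm B x b - Lm B b x ∈ B.Osub) :
    Lm B x (Lm B a b) - Lm B (Lm B a b) x ∈ B.Osub := by
  have h1 := assoc hB x a b
  have h2 := right_ideal hB b ha
  have h3 := assoc hB a x b
  have h4 := left_ideal hB a hb
  have h5 := assoc hB a b x
  simp only [map_sub, LinearMap.sub_apply] at h2 h4
  have := Submodule.sub_mem _ (Submodule.add_mem _ (Submodule.add_mem _
    (Submodule.sub_mem _ h2 h1) h3) h4) h5
  convert this using 1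
  abel

end general
end ZhuPf


namespace ZhuPf

section general
variable {W : Type} [AddCommGroup W] [Module ℂ W] {B : VOA W}

/-- The preimage of the subalgebra generated by `G`. -/
noncomputable def PG (B : VOA W) (G : Set W) : Submodule ℂ W := genMonomials B G ⊔ B.Osub

theorem PG_O (G : Set W) : B.Osub ≤ PG B G := le_sup_right

theorem PG_list (G : Set W) (L : List W) (hL : ∀ g ∈ L, g ∈ G) : starList B L ∈ PG B G :=
  le_sup_left (a := genMonomials B G) (Submodule.subset_span ⟨L, hL, rfl⟩)

theorem PG_one (G : Set W) : B.one ∈ PG B G := PG_list G [] (by simp)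

theorem PG_gen (hB : CFT B) {G : Set W} {g : W} (hg : g ∈ G) : g ∈ PG B G := by
  have h := PG_list (B := B) G [g] (by simpa using hg)
  simp only [starList] at h
  rwa [star_eq hB, Lm_right_one hB] at h

theorem PG_induct (hB : CFT B) {G : Set W} (U : Submodule ℂ W) (hO : B.Osub ≤ U) (h1 : B.one ∈ U)
    (h : ∀ g ∈ G, ∀ x ∈ PG B G, x ∈ U → Lm B g x ∈ U) : PG B G ≤ U := by
  refine sup_le (Submodule.span_le.2 ?_) hO
  rintro w ⟨L, hL, rfl⟩
  have : starList B L ∈ PG B G ∧ starList B L ∈ U := by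
    induction L with
    | nil => exact ⟨PG_list G _ hL, h1⟩
    | cons g L ih =>
      obtain ⟨i1, i2⟩ := ih (fun x hx => hL x (List.mem_cons_of_mem _ hx))
      refine ⟨PG_list G _ hL, ?_⟩
      simp only [starList]
      rw [star_eq hB]
      exact h g (hL g List.mem_cons_self) _ i1 i2
  exact this.2

theorem PG_gen_mul (hB : CFT B) {G : Set W} {g : W} (hg : g ∈ G) {x : W} (hx : x ∈ PG B G) :
    Lm B g x ∈ PG B G := by
  have h : PG B G ≤ (PG B G).comap (Lm B g) := by
    refine sup_le (Submodule.span_le.2 ?_) ?_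
    · rintro w ⟨L, hL, rfl⟩
      show Lm B g (starList B L) ∈ PG B G
      rw [← star_eq hB]
      refine PG_list G (g :: L) ?_
      intro y hy
      rcases List.mem_cons.1 hy with rfl | hy
      · exact hg
      · exact hL _ hy
    · intro o ho
      exact PG_O G (left_ideal hB g ho)
  exact h hx

theorem PG_mul (hB : CFT B) {G : Set W} {x y : W} (hx : x ∈ PG B G) (hy : y ∈ PG B G) :
    Lm B x y ∈ PG B G := by
  have h : PG B G ≤ (PG B G).comap ((Lm B).flip y) := by
    refine PG_induct hB _ ?_ ?_ ?_
    · intro o ho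
      exact PG_O G (right_ideal hB y ho)
    · show Lm B B.one y ∈ PG B G
      rw [Lm_one]; exact hy
    · intro g hg x _ hx
      show Lm B (Lm B g x) y ∈ PG B G
      have h1 := PG_O G (assoc hB g x y)
      have h2 := PG_gen_mul hB hg (show Lm B x y ∈ PG B G from hx)
      have := Submodule.add_mem _ h1 h2
      rwa [sub_add_cancel] at this
  exact h hx

theorem PG_comm (hB : CFT B) {G : Set W}
    (hG : ∀ g ∈ G, ∀ g' ∈ G, Lm B g g' - Lm B g' g ∈ B.Osub) {x y : W} (hx : x ∈ PG B G)
    (hy : y ∈ PG B G) : Lm B x y - Lm B y x ∈ B.Osub := by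
  have key : ∀ x : W, (∀ g ∈ G, Lm B x g - Lm B g x ∈ B.Osub) →
      ∀ y ∈ PG B G, Lm B x y - Lm B y x ∈ B.Osub := by
    intro x hx
    have h : PG B G ≤ B.Osub.comap (Lm B x - (Lm B).flip x) := by
      refine PG_induct hB _ ?_ ?_ ?_
      · intro o ho
        exact Submodule.sub_mem _ (left_ideal hB x ho) (right_ideal hB x ho)
      · show Lm B x B.one - Lm B B.one x ∈ B.Osub
        rw [Lm_one, Lm_right_one hB, sub_self]; exact Submodule.zero_mem _
      · intro g hg z _ hz
        exact comm_mul hB x g z (hx g hg) hz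
    exact fun y hy => h hy
  refine key x ?_ y hy
  intro g hg
  have := key g (fun g' hg' => hG g hg g' hg') x hx
  rw [← Submodule.neg_mem_iff, neg_sub]; exact this

theorem PG_mode (hB : CFT B) {G : Set W} {s v : W} (k : ℕ) (hk : s ∈ B.wt k) (hs : s ∈ PG B G)
    (hv : v ∈ PG B G) (n : ℕ) (h : ∀ j : ℤ, -((n+1:ℕ):ℤ) < j → B.Y s j v ∈ PG B G) :
    B.Y s (-((n+1:ℕ):ℤ)) v ∈ PG B G := by
  have h1 : Yf B s (zp k (-((n+1:ℕ):ℤ))) v ∈ PG B G := by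
    cases n with
    | zero =>
      have := PG_mul hB hs hv
      rwa [Lm_wt B k s hk] at this
    | succ n => exact PG_O G (mem_O B k s v hk n)
  rw [Yf_zp, Finset.sum_range_succ', Submodule.add_mem_iff_right] at h1
  · simpa using h1
  · refine Submodule.sum_mem _ fun i _ => Submodule.smul_mem _ _ (h _ ?_)
    push_cast; omega

theorem L1_O (k : ℕ) (v : W) (hv : v ∈ B.wt k) : B.Y B.omega 0 v + (k:ℂ) • v ∈ B.Osub := by
  have h := vac_O k v hv 1
  have e : B.Y B.omega 0 v = B.Y v (-1 - (1:ℕ)) B.one := by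
    have h1 := B.create (B.Y B.omega 0 v)
    rw [B.translation] at h1
    rw [← h1]; simp
  rw [e]
  rw [zchoose_one] at h
  simpa using h

end general
end ZhuPf


namespace ZhuPf

section heis
variable {V : Type} [AddCommGroup V] [Module ℂ V] {A : VOA V} {ℓ : ℕ} {hgen : Fin ℓ → V}

/-- The vector of a word. -/
noncomputable def wd (A : VOA V) (hgen : Fin ℓ → V) (L : List (Fin ℓ × ℕ+)) : V :=
  wordAct (fun a k w => A.Y (hgen a) k w) L A.one

theorem wd_nil : wd A hgen [] = A.one := rfl

theorem wd_cons (a : Fin ℓ) (n : ℕ+) (L : List (Fin ℓ × ℕ+)) :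
    wd A hgen ((a, n) :: L) = A.Y (hgen a) (-((n : ℕ) : ℤ)) (wd A hgen L) := rfl

/-- Weight of a word. -/
def wsum (L : List (Fin ℓ × ℕ+)) : ℕ := (L.map fun p => (p.2 : ℕ)).sum

theorem wsum_cons (p : Fin ℓ × ℕ+) (L : List (Fin ℓ × ℕ+)) :
    wsum (p :: L) = p.2 + wsum L := by simp [wsum]

theorem wd_wt (hH : IsHeisenberg A hgen) (L : List (Fin ℓ × ℕ+)) :
    wd A hgen L ∈ A.wt (wsum L) := by
  induction L with
  | nil => exact A.one_wt
  | cons p L ih =>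
    have := A.mode_wt 1 _ (hH.wt_one p.1) _ (-((p.2:ℕ):ℤ)) _ ih
    rw [wsum_cons]
    have e : (((p.2:ℕ) + wsum L : ℕ) : ℤ) = (wsum L : ℤ) + 1 - -((p.2:ℕ):ℤ) - 1 := by
      push_cast; ring
    rw [e]; exact this

/-- Homogeneous components as a linear map. -/
noncomputable def hc (A : VOA V) (k : ℤ) : Module.End ℂ V :=
  (A.wt k).subtype ∘ₗ DirectSum.component ℂ ℤ (fun k => A.wt k) k ∘ₗ A.decompose.toLinearMap

theorem hc_self (k : ℤ) (x : V) (hx : x ∈ A.wt k) : hc A k x = x := by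
  simp only [hc, LinearMap.comp_apply, LinearEquiv.coe_coe]
  rw [decompose_mem A k x hx, DirectSum.component.lof_self]
  rfl

theorem hc_ne (k l : ℤ) (x : V) (hx : x ∈ A.wt l) (h : l ≠ k) : hc A k x = 0 := by
  simp only [hc, LinearMap.comp_apply, LinearEquiv.coe_coe]
  rw [decompose_mem A l x hx, DirectSum.component.of, dif_neg h]
  rfl

theorem wt_span (hH : IsHeisenberg A hgen) (k : ℤ) (x : V) (hx : x ∈ A.wt k) :
    x ∈ Submodule.span ℂ {v | ∃ L : List (Fin ℓ × ℕ+), (wsum L : ℤ) = k ∧ v = wd A hgen L} := by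
  have h : (⊤ : Submodule ℂ V) ≤ (Submodule.span ℂ {v | ∃ L : List (Fin ℓ × ℕ+),
      (wsum L : ℤ) = k ∧ v = wd A hgen L}).comap (hc A k) := by
    rw [← hH.span_words, Submodule.span_le]
    rintro w ⟨L, rfl⟩
    show hc A k (wd A hgen L) ∈ Submodule.span ℂ {v | ∃ L : List (Fin ℓ × ℕ+),
      (wsum L : ℤ) = k ∧ v = wd A hgen L}
    by_cases hk : (wsum L : ℤ) = k
    · rw [hc_self k _ (hk ▸ wd_wt hH L)]
      exact Submodule.subset_span ⟨L, hk, rfl⟩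
    · rw [hc_ne k _ _ (wd_wt hH L) hk]
      exact Submodule.zero_mem _
  have := h (Submodule.mem_top (x := x))
  rwa [Submodule.mem_comap, hc_self k x hx] at this

theorem cft_A (hH : IsHeisenberg A hgen) : CFT A := by
  constructor
  · intro k hk
    rw [eq_bot_iff]
    intro x hx
    have h := wt_span hH k x hx
    have e : {v | ∃ L : List (Fin ℓ × ℕ+), (wsum L : ℤ) = k ∧ v = wd A hgen L} = ∅ := by
      ext v
      simp only [Set.mem_ofPred_eq, Set.mem_empty_iff_false, iff_false]
      rintro ⟨L, hL, _⟩
      omega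
    rwa [e, Submodule.span_empty] at h
  · intro x hx
    have h := wt_span hH 0 x hx
    have e : Submodule.span ℂ {v | ∃ L : List (Fin ℓ × ℕ+), (wsum L : ℤ) = 0 ∧ v = wd A hgen L}
        ≤ Submodule.span ℂ {A.one} := by
      rw [Submodule.span_le]
      rintro v ⟨L, hL, rfl⟩
      cases L with
      | nil => exact Submodule.mem_span_singleton_self _
      | cons p L =>
        rw [wsum_cons] at hL
        have := p.2.pos
        omega
    obtain ⟨c, hc⟩ := Submodule.mem_span_singleton.1 (e h)
    exact ⟨c, hc.symm⟩

theorem cft_B {W : Type} [AddCommGroup W] [Module ℂ W] (hA : CFT A) {θ : V ≃ₗ[ℂ] V} {B : VOA W}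
    {ι : W →ₗ[ℂ] V} (hF : IsFixedSubVOA A θ B ι) : CFT B := by
  constructor
  · intro k hk
    rw [eq_bot_iff]
    intro x hx
    have := (hF.map_wt k x).1 hx
    rw [hA.neg k hk, Submodule.mem_bot] at this
    rw [Submodule.mem_bot]
    apply hF.inj
    rw [this, map_zero]
  · intro x hx
    obtain ⟨c, hc⟩ := hA.zero _ ((hF.map_wt 0 x).1 hx)
    refine ⟨c, hF.inj ?_⟩
    rw [hc, map_smul, hF.map_one]

/-! ### Parity filtered spans -/

/-- Parity vector of a word. -/
def par : List (Fin ℓ × ℕ+) → Fin ℓ → ZMod 2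
  | [] => 0
  | p :: L => par L + Pi.single p.1 1

/-- Span of the words with given parity and weight and bounded length. -/
noncomputable def Wd (A : VOA V) (hgen : Fin ℓ → V) (p : Fin ℓ → ZMod 2) (e r : ℤ) :
    Submodule ℂ V :=
  Submodule.span ℂ {v | ∃ L : List (Fin ℓ × ℕ+), par L = p ∧ (wsum L : ℤ) = e ∧
    (L.length : ℤ) ≤ r ∧ v = wd A hgen L}

theorem wd_mem (L : List (Fin ℓ × ℕ+)) : wd A hgen L ∈ Wd A hgen (par L) (wsum L) L.length :=
  Submodule.subset_span ⟨L, rfl, rfl, le_rfl, rfl⟩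

theorem Wd_mono (p : Fin ℓ → ZMod 2) (e : ℤ) {r s : ℤ} (h : r ≤ s) :
    Wd A hgen p e r ≤ Wd A hgen p e s := by
  refine Submodule.span_mono ?_
  rintro v ⟨L, h1, h2, h3, rfl⟩
  exact ⟨L, h1, h2, h3.trans h, rfl⟩

theorem Wd_cast {p p' : Fin ℓ → ZMod 2} {e e' r r' : ℤ} {x : V} (h : x ∈ Wd A hgen p e r)
    (h1 : p = p') (h2 : e = e') (h3 : r ≤ r') : x ∈ Wd A hgen p' e' r' := by
  subst h1; subst h2; exact Wd_mono _ _ h3 h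

theorem single_self (p : Fin ℓ → ZMod 2) (a : Fin ℓ) :
    p + Pi.single a 1 + Pi.single a 1 = p := by
  ext c
  simp only [Pi.add_apply, add_assoc, CharTwo.add_self_eq_zero, add_zero]

theorem Wd_wt (hH : IsHeisenberg A hgen) (p : Fin ℓ → ZMod 2) (e r : ℤ) :
    Wd A hgen p e r ≤ A.wt e := by
  refine Submodule.span_le.2 ?_
  rintro v ⟨L, h1, rfl, h3, rfl⟩
  exact wd_wt hH L

theorem h_neg (a : Fin ℓ) (n : ℤ) (hn : n < 0) {p : Fin ℓ → ZMod 2} {e r : ℤ} {x : V}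
    (hx : x ∈ Wd A hgen p e r) : A.Y (hgen a) n x ∈ Wd A hgen (p + Pi.single a 1) (e - n) (r+1) := by
  have h : Wd A hgen p e r ≤ (Wd A hgen (p + Pi.single a 1) (e - n) (r+1)).comap
      (A.Y (hgen a) n) := by
    refine Submodule.span_le.2 ?_
    rintro v ⟨L, h1, h2, h3, rfl⟩
    obtain ⟨k, rfl⟩ : ∃ k : ℕ+, n = -((k:ℕ):ℤ) :=
      ⟨⟨(-n).toNat, by omega⟩, by simp; omega⟩
    refine Submodule.subset_span ⟨(a, k) :: L, ?_, ?_, ?_, rfl⟩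
    · rw [par, h1]
    · rw [wsum_cons]; push_cast; omega
    · simp; omega
  exact h hx

theorem heis_apply (hH : IsHeisenberg A hgen) (a b : Fin ℓ) (m n : ℤ) (w : V) :
    A.Y (hgen a) m (A.Y (hgen b) n w) = A.Y (hgen b) n (A.Y (hgen a) m w)
      + (if a = b ∧ m + n = 0 then (m : ℂ) else 0) • w := by
  have := congrArg (fun f : Module.End ℂ V => f w) (hH.heis_comm a b m n)
  simp only [LinearMap.sub_apply, Module.End.mul_apply, LinearMap.smul_apply,
    Module.End.one_apply] at this
  rw [sub_eq_iff_eq_add] at this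
  rw [this, add_comm]

theorem h_nonneg (hH : IsHeisenberg A hgen) (a : Fin ℓ) (n : ℤ) (hn : 0 ≤ n)
    {p : Fin ℓ → ZMod 2} {e r : ℤ} {x : V}
    (hx : x ∈ Wd A hgen p e r) : A.Y (hgen a) n x ∈ Wd A hgen (p + Pi.single a 1) (e - n) (r-1) := by
  have key : ∀ L : List (Fin ℓ × ℕ+), A.Y (hgen a) n (wd A hgen L)
      ∈ Wd A hgen (par L + Pi.single a 1) (wsum L - n) (L.length - 1) := by
    intro L
    induction L with
    | nil => rw [wd_nil, A.create_ge _ _ hn]; exact Submodule.zero_mem _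
    | cons q L ih =>
      obtain ⟨b, k⟩ := q
      rw [wd_cons, heis_apply hH]
      refine Submodule.add_mem _ ?_ ?_
      · have := h_neg b (-((k:ℕ):ℤ)) (by have := k.pos; omega) ih
        refine Wd_cast this ?_ ?_ ?_
        · rw [par]; abel
        · rw [wsum_cons]; push_cast; ring
        · simp
      · split_ifs with h
        · obtain ⟨rfl, h⟩ := h
          refine Submodule.smul_mem _ _ ?_
          have := wd_mem (A := A) (hgen := hgen) L
          refine Wd_cast this ?_ ?_ ?_
          · rw [par, single_self]
          · rw [wsum_cons]; push_cast; omega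
          · simp
        · simp
  have h : Wd A hgen p e r ≤ (Wd A hgen (p + Pi.single a 1) (e - n) (r-1)).comap
      (A.Y (hgen a) n) := by
    refine Submodule.span_le.2 ?_
    rintro v ⟨L, rfl, rfl, h3, rfl⟩
    exact Wd_mono _ _ (by omega) (key L)
  exact h hx

theorem h_any (hH : IsHeisenberg A hgen) (a : Fin ℓ) (n : ℤ)
    {p : Fin ℓ → ZMod 2} {e r : ℤ} {x : V}
    (hx : x ∈ Wd A hgen p e r) : A.Y (hgen a) n x ∈ Wd A hgen (p + Pi.single a 1) (e - n) (r+1) := by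
  by_cases hn : n < 0
  · exact h_neg a n hn hx
  · exact Wd_mono _ _ (by omega) (h_nonneg hH a n (by omega) hx)

/-- Creation operators commute, so words may be permuted. -/
theorem wd_perm (hH : IsHeisenberg A hgen) {L L' : List (Fin ℓ × ℕ+)} (h : L.Perm L') :
    wd A hgen L = wd A hgen L' := by
  induction h with
  | nil => rfl
  | cons p _ ih => obtain ⟨a, n⟩ := p; rw [wd_cons, wd_cons, ih]
  | swap p q L =>
    obtain ⟨a, n⟩ := p
    obtain ⟨b, m⟩ := q
    rw [wd_cons, wd_cons, wd_cons, wd_cons, heis_apply hH, if_neg, zero_smul, add_zero]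
    rintro ⟨_, h⟩
    have := n.pos
    have := m.pos
    omega
  | trans _ _ ih1 ih2 => rw [ih1, ih2]

theorem par_perm {L L' : List (Fin ℓ × ℕ+)} (h : L.Perm L') : par L = par L' := by
  induction h with
  | nil => rfl
  | cons p _ ih => rw [par, par, ih]
  | swap p q L => simp only [par]; abel
  | trans _ _ ih1 ih2 => rw [ih1, ih2]

theorem wsum_perm {L L' : List (Fin ℓ × ℕ+)} (h : L.Perm L') : wsum L = wsum L' :=
  (h.map _).sum_eq

theorem par_count (L : List (Fin ℓ × ℕ+)) (c : Fin ℓ) :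
    par L c = (((L.map Prod.fst).count c : ℕ) : ZMod 2) := by
  induction L with
  | nil => simp [par]
  | cons p L ih =>
    rw [par, Pi.add_apply, ih, List.map_cons, List.count_cons]
    by_cases h : p.1 = c
    · subst h; simp
    · simp [h, Ne.symm h]

theorem par_sum (L : List (Fin ℓ × ℕ+)) : ∑ c, par L c = ((L.length : ℕ) : ZMod 2) := by
  induction L with
  | nil => simp [par]
  | cons p L ih =>
    simp only [par, Pi.add_apply, Finset.sum_add_distrib, ih]
    simp

theorem theta_wd {θ : V ≃ₗ[ℂ] V} (hθ : IsThetaAut A hgen θ) (L : List (Fin ℓ × ℕ+)) :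
    θ (wd A hgen L) = (-1 : ℂ) ^ L.length • wd A hgen L := by
  induction L with
  | nil => simp [wd_nil, hθ.map_one]
  | cons p L ih =>
    obtain ⟨a, n⟩ := p
    rw [wd_cons, hθ.map_Y, ih, hθ.map_gen, map_smul, map_neg]
    simp [pow_succ]

end heis
end ZhuPf


namespace ZhuPf

section heis
variable {V : Type} [AddCommGroup V] [Module ℂ V] {A : VOA V} {ℓ : ℕ} {hgen : Fin ℓ → V}

theorem zchoose_absorb (q : ℤ) (n : ℕ) :
    ((n:ℂ) + 1) * zchoose q (n+1) = q * zchoose (q-1) n := by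
  have h1 := zchoose_pascal (q-1) n
  have h2 := zchoose_succ_mul (q-1) n
  rw [sub_add_cancel] at h1
  push_cast at h2
  rw [h1]
  linear_combination h2

theorem zero_mode (u v w : V) (n : ℤ) :
    A.Y u 0 (A.Y v n w) = A.Y v n (A.Y u 0 w) + A.Y (A.Y u 0 v) n w := by
  obtain ⟨N, hN⟩ := exists_bound A u v
  have h := comm_modes A u v w (N+1) (fun i hi => hN i (by omega)) 0 n
  rw [Finset.sum_range_succ', Finset.sum_eq_zero, sub_eq_iff_eq_add] at h
  · rw [h]; simp [add_comm]
  · intro i _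
    rw [zchoose_zero_succ, zero_smul]

theorem omega0_h (a : Fin ℓ) (n : ℤ) (w : V) :
    A.Y A.omega 0 (A.Y (hgen a) n w) = A.Y (hgen a) n (A.Y A.omega 0 w)
      - (n:ℂ) • A.Y (hgen a) (n-1) w := by
  rw [zero_mode, A.translation]
  simp [sub_eq_add_neg]

theorem omega0_one : A.Y A.omega 0 A.one = 0 := A.create_ge _ _ le_rfl

/-- The vectors `h_a(-1-n) 1`. -/
noncomputable def Xv (A : VOA V) (hgen : Fin ℓ → V) (a : Fin ℓ) (n : ℕ) : V :=
  A.Y (hgen a) (-1 - n) A.one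

theorem X_modes (a : Fin ℓ) (n : ℕ) (q : ℤ) :
    A.Y (Xv A hgen a n) q = ((-1) ^ n * zchoose q n) • A.Y (hgen a) (q - n) := by
  induction n generalizing q with
  | zero => simp [Xv, A.create]
  | succ n ih =>
    have e : A.Y A.omega 0 (Xv A hgen a n) = ((n:ℂ)+1) • Xv A hgen a (n+1) := by
      rw [Xv, omega0_h, omega0_one, map_zero, Xv]
      rw [show (-1 - ((n+1:ℕ):ℤ)) = -1 - n - 1 by push_cast; ring]
      push_cast
      module
    have h := A.translation (Xv A hgen a n) q
    rw [e, map_smul, ih] at h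
    have hn : ((n:ℂ)+1) ≠ 0 := by exact_mod_cast Nat.succ_ne_zero n
    have h2 := congrArg (fun f => ((n:ℂ)+1)⁻¹ • f) h
    simp only [Pi.smul_apply, smul_smul, inv_mul_cancel₀ hn, one_smul] at h2
    rw [h2, show (q - ((n+1:ℕ):ℤ)) = q - 1 - n by push_cast; ring]
    congr 1
    have h3 := zchoose_absorb q n
    field_simp
    rw [pow_succ]
    linear_combination (-1)^n * h3

theorem X_modes_neg_one (a : Fin ℓ) (n : ℕ) :
    A.Y (Xv A hgen a n) (-1) = A.Y (hgen a) (-1-n) := by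
  rw [X_modes, zchoose_neg_one, ← mul_pow]
  simp

theorem X_modes_mem (hH : IsHeisenberg A hgen) (a : Fin ℓ) (n : ℕ) (q : ℤ) {p : Fin ℓ → ZMod 2}
    {e r : ℤ} {x : V} (hx : x ∈ Wd A hgen p e r) :
    A.Y (Xv A hgen a n) q x ∈ Wd A hgen (p + Pi.single a 1) (e - q + n) (r+1) := by
  rw [X_modes, LinearMap.smul_apply]
  refine Submodule.smul_mem _ _ (Wd_cast (h_any hH a (q - n) hx) rfl (by ring) le_rfl)

theorem X_modes_mem_nonneg (hH : IsHeisenberg A hgen) (a : Fin ℓ) (n : ℕ) (q : ℤ) (hq : 0 ≤ q)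
    {p : Fin ℓ → ZMod 2} {e r : ℤ} {x : V} (hx : x ∈ Wd A hgen p e r) :
    A.Y (Xv A hgen a n) q x ∈ Wd A hgen (p + Pi.single a 1) (e - q + n) (r-1) := by
  rw [X_modes, LinearMap.smul_apply]
  by_cases hqn : q < n
  · lift q to ℕ using hq
    rw [zchoose_nat, Nat.choose_eq_zero_of_lt (by omega)]
    simp
  · exact Submodule.smul_mem _ _ (Wd_cast (h_nonneg hH a (q - n) (by omega) hx) rfl (by ring) le_rfl)

/-- Modes of a normally ordered product. -/
theorem S_modes (u x w : V) (m : ℕ) (j : ℤ) : ∃ N : ℕ,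
    A.Y (A.Y u (-m) x) j w = ∑ i ∈ Finset.range (N+1), ((-1 : ℂ) ^ i * zchoose (-m) i) •
      (A.Y u (-m - i) (A.Y x (j + i) w) - ((-1 : ℂ) ^ (-m : ℤ)) • A.Y x (j - m - i) (A.Y u i w)) := by
  obtain ⟨N1, h1⟩ := A.trunc u w
  obtain ⟨N2, h2⟩ := A.trunc x w
  have h := A.borcherds u x w (-m) 0 j
  refine ⟨N1.toNat + (N2 - j).toNat, ?_⟩
  rw [finsum_eq_single _ 0, finsum_eq_sum_of_support_subset
    (s := Finset.range (N1.toNat + (N2 - j).toNat + 1))] at h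
  · simp only [zchoose_zero, one_smul, Nat.cast_zero, add_zero, sub_zero, zero_add] at h
    rw [h]
    rfl
  · intro i hi
    simp only [Finset.coe_range, Set.mem_Iio]
    by_contra hc
    apply hi
    show ((-1 : ℂ) ^ i * zchoose (-m) i) •
      (A.Y u (0 + -m - i) (A.Y x (j + i) w)
        - ((-1 : ℂ) ^ (-m : ℤ)) • A.Y x (j + -m - i) (A.Y u (0 + i) w)) = 0
    rw [h1 _ (by omega), h2 _ (by omega)]
    simp
  · intro i hi
    obtain ⟨k, rfl⟩ := Nat.exists_eq_succ_of_ne_zero hi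
    rw [Nat.succ_eq_add_one, zchoose_zero_succ, zero_smul]

/-- `S_a(m, n+1)`. -/
noncomputable def Sm (A : VOA V) (hgen : Fin ℓ → V) (a : Fin ℓ) (m n : ℕ) : V :=
  A.Y (hgen a) (-m) (Xv A hgen a n)

theorem Sm_mode_mem (hH : IsHeisenberg A hgen) (a : Fin ℓ) (m n : ℕ) (j : ℤ)
    {p : Fin ℓ → ZMod 2} {e r : ℤ} {x : V} (hx : x ∈ Wd A hgen p e r) :
    A.Y (Sm A hgen a m n) j x ∈ Wd A hgen p (e + m + n - j) (r+2) := by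
  obtain ⟨N, hN⟩ := S_modes (A := A) (hgen a) (Xv A hgen a n) x m j
  rw [Sm, hN]
  refine Submodule.sum_mem _ fun i _ => Submodule.smul_mem _ _ (Submodule.sub_mem _ ?_
    (Submodule.smul_mem _ _ ?_))
  · exact Wd_cast (h_any hH a _ (X_modes_mem hH a n _ hx)) (single_self p a) (by ring) (by omega)
  · exact Wd_cast (X_modes_mem hH a n _ (h_any hH a _ hx)) (single_self p a) (by ring) (by omega)

theorem Sm_mode_neg_one (hH : IsHeisenberg A hgen) (a : Fin ℓ) (m n : ℕ)
    {p : Fin ℓ → ZMod 2} {e r : ℤ} {x : V} (hx : x ∈ Wd A hgen p e r) :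
    A.Y (hgen a) (-m) (A.Y (hgen a) (-1-n) x) - A.Y (Sm A hgen a m n) (-1) x
      ∈ Wd A hgen p (e + m + n + 1) r := by
  obtain ⟨N, hN⟩ := S_modes (A := A) (hgen a) (Xv A hgen a n) x m (-1)
  rw [Sm, hN, Finset.sum_range_succ']
  have h2 : ∀ i : ℕ, A.Y (Xv A hgen a n) (-1 - m - i) (A.Y (hgen a) i x)
      ∈ Wd A hgen p (e + m + n + 1) r := fun i =>
    Wd_cast (X_modes_mem hH a n _ (h_nonneg hH a i (by omega) hx)) (single_self p a)
      (by ring) (by omega)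
  rw [← sub_sub, sub_right_comm]
  refine Submodule.sub_mem _ ?_ (Submodule.sum_mem _ fun i _ => Submodule.smul_mem _ _
    (Submodule.sub_mem _ ?_ (Submodule.smul_mem _ _ (h2 _))))
  · simp only [Nat.cast_zero, sub_zero, add_zero, pow_zero, zchoose_zero, one_mul, one_smul,
      X_modes_neg_one]
    rw [sub_sub_cancel]
    refine Submodule.smul_mem _ _ ?_
    have := h2 0
    simpa using this
  · exact Wd_cast (h_any hH a _ (X_modes_mem_nonneg hH a n _ (by push_cast; omega) hx))
      (single_self p a) (by push_cast; ring) (by omega)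

end heis
end ZhuPf


namespace ZhuPf

section heis
variable {V : Type} [AddCommGroup V] [Module ℂ V] {A : VOA V} {ℓ : ℕ} {hgen : Fin ℓ → V}

/-- `S_a(m,n)` with natural number indices. -/
noncomputable def Sn (A : VOA V) (hgen : Fin ℓ → V) (a : Fin ℓ) (m n : ℕ) : V :=
  A.Y (hgen a) (-(m:ℤ)) (A.Y (hgen a) (-(n:ℤ)) A.one)

theorem Sm_eq (a : Fin ℓ) (m n : ℕ) : Sm A hgen a m n = Sn A hgen a m (n+1) := by
  rw [Sm, Sn, Xv, show (-1 - (n:ℤ)) = -((n+1:ℕ):ℤ) by push_cast; ring]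

theorem Sn_eq (a : Fin ℓ) (m n : ℕ) : Sn A hgen a m n = SV A hgen a a m n := rfl

theorem om_eq (a : Fin ℓ) : omegaV A hgen a = (1/2 : ℂ) • Sn A hgen a 1 1 := rfl

theorem Sn_mem (a : Fin ℓ) (m n : ℕ) (hm : 1 ≤ m) (hn : 1 ≤ n) :
    Sn A hgen a m n ∈ Wd A hgen 0 (m + n) 2 := by
  have h := wd_mem (A := A) (hgen := hgen) [(a, ⟨m, hm⟩), (a, ⟨n, hn⟩)]
  refine Wd_cast h ?_ ?_ ?_
  · simp only [par]; exact single_self 0 a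
  · simp [wsum]
  · simp

theorem h_comm_neg (hH : IsHeisenberg A hgen) (a b : Fin ℓ) (m n : ℤ) (h : m + n ≠ 0) (w : V) :
    A.Y (hgen a) m (A.Y (hgen b) n w) = A.Y (hgen b) n (A.Y (hgen a) m w) := by
  rw [heis_apply hH, if_neg (by tauto), zero_smul, add_zero]

theorem Sn_symm (hH : IsHeisenberg A hgen) (a : Fin ℓ) (m n : ℕ) (hm : 1 ≤ m) :
    Sn A hgen a m n = Sn A hgen a n m := h_comm_neg hH a a _ _ (by omega) _

theorem L1_Sn (a : Fin ℓ) (m n : ℕ) : A.Y A.omega 0 (Sn A hgen a m n)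
    = (m:ℂ) • Sn A hgen a (m+1) n + (n:ℂ) • Sn A hgen a m (n+1) := by
  simp only [Sn, omega0_h, omega0_one, map_zero, map_sub, map_smul]
  rw [show (-((m+1:ℕ):ℤ)) = -(m:ℤ) - 1 by push_cast; ring,
    show (-((n+1:ℕ):ℤ)) = -(n:ℤ) - 1 by push_cast; ring]
  push_cast
  module

theorem h_om (hH : IsHeisenberg A hgen) (a b : Fin ℓ) (n : ℤ) (hn : 0 ≤ n) :
    A.Y (hgen b) n (omegaV A hgen a) = if b = a ∧ n = 1 then hgen a else 0 := by
  rw [om_eq, map_smul, Sn, heis_apply hH b a, heis_apply hH b a n _ A.one,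
    A.create_ge _ _ hn, map_zero, zero_add, map_smul]
  have e : (-((1:ℕ):ℤ)) = -1 := by norm_num
  rw [e, A.create]
  by_cases h : b = a ∧ n = 1
  · obtain ⟨rfl, rfl⟩ := h
    simp only [and_self, if_true, Int.cast_one]
    norm_num
    rw [← add_smul]; norm_num
  · rw [if_neg h, if_neg (by rintro ⟨h1, h2⟩; exact h ⟨h1, by omega⟩)]
    simp

/-- Commutator of the modes of `ω_a` with the Heisenberg generators. -/
theorem om_h (hH : IsHeisenberg A hgen) (a b : Fin ℓ) (j n : ℤ) (w : V) :
    A.Y (omegaV A hgen a) j (A.Y (hgen b) n w) = A.Y (hgen b) n (A.Y (omegaV A hgen a) j w)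
      - (if b = a then (n:ℂ) else 0) • A.Y (hgen a) (n + j - 1) w := by
  have h := comm_modes A (hgen b) (omegaV A hgen a) w 2 (fun i hi => by
    rw [h_om hH _ _ _ (by omega), if_neg]
    rintro ⟨_, h⟩
    omega) n j
  rw [Finset.sum_range_succ, Finset.sum_range_one, h_om hH _ _ _ (by simp),
    h_om hH _ _ _ (by simp), if_neg (by simp)] at h
  simp only [map_zero, Pi.zero_apply, LinearMap.zero_apply, smul_zero, zero_add, zchoose_one,
    Nat.cast_one, and_true] at h
  rw [sub_eq_iff_eq_add] at h
  rw [h]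
  by_cases hb : b = a
  · subst hb
    simp only [if_true]
    abel
  · simp [hb]

theorem om_Sn_one (a : Fin ℓ) : A.Y (omegaV A hgen a) (-1) A.one = omegaV A hgen a := A.create _

theorem om_two (hH : IsHeisenberg A hgen) (a : Fin ℓ) :
    A.Y (omegaV A hgen a) (-2) A.one = Sn A hgen a 1 2 := by
  have h1 := A.create (A.Y A.omega 0 (omegaV A hgen a))
  rw [A.translation] at h1
  norm_num at h1
  rw [h1, om_eq, map_smul, L1_Sn, Sn_symm hH a 2 1 (by norm_num)]
  push_cast
  module

theorem om_neg_one_Sn (hH : IsHeisenberg A hgen) (a : Fin ℓ) (m n : ℕ) :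
    A.Y (omegaV A hgen a) (-1) (Sn A hgen a m n)
    = (m:ℂ) • Sn A hgen a (m+2) n + (n:ℂ) • Sn A hgen a m (n+2)
      + A.Y (hgen a) (-(m:ℤ)) (A.Y (hgen a) (-(n:ℤ)) (omegaV A hgen a)) := by
  simp only [Sn, om_h hH, if_true, map_sub, map_smul, om_Sn_one]
  rw [show (-((m+2:ℕ):ℤ)) = -(m:ℤ) + -1 - 1 by push_cast; ring,
    show (-((n+2:ℕ):ℤ)) = -(n:ℤ) + -1 - 1 by push_cast; ring]
  push_cast
  module

theorem om_neg_two_Sn (hH : IsHeisenberg A hgen) (a : Fin ℓ) (m n : ℕ) :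
    A.Y (omegaV A hgen a) (-2) (Sn A hgen a m n)
    = (m:ℂ) • Sn A hgen a (m+3) n + (n:ℂ) • Sn A hgen a m (n+3)
      + A.Y (hgen a) (-(m:ℤ)) (A.Y (hgen a) (-(n:ℤ)) (Sn A hgen a 1 2)) := by
  rw [← om_two hH]
  simp only [Sn, om_h hH, if_true, map_sub, map_smul]
  rw [show (-((m+3:ℕ):ℤ)) = -(m:ℤ) + -2 - 1 by push_cast; ring,
    show (-((n+3:ℕ):ℤ)) = -(n:ℤ) + -2 - 1 by push_cast; ring]
  push_cast
  module

/-- The weight four identity for `J_a`. -/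
theorem J_eq (hH : IsHeisenberg A hgen) (a : Fin ℓ) : JV A hgen a
    = (2:ℂ) • A.Y (omegaV A hgen a) (-1) (Sn A hgen a 1 1) - (9:ℂ) • Sn A hgen a 1 3
      + (3/2:ℂ) • A.Y A.omega 0 (Sn A hgen a 1 2) := by
  have e1 : JV A hgen a = A.Y (hgen a) (-((1:ℕ):ℤ)) (A.Y (hgen a) (-((1:ℕ):ℤ)) (Sn A hgen a 1 1))
    - (2:ℂ) • Sn A hgen a 3 1 + (3/2:ℂ) • Sn A hgen a 2 2 := rfl
  rw [e1, om_neg_one_Sn hH, L1_Sn, om_eq, map_smul, map_smul, Sn_symm hH a 3 1 (by norm_num)]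
  push_cast
  module

/-- The higher weight identity. -/
theorem high_eq (hH : IsHeisenberg A hgen) (a : Fin ℓ) (n : ℕ) :
    A.Y (omegaV A hgen a) (-2) (Sn A hgen a 1 n)
      - (2:ℂ) • A.Y (omegaV A hgen a) (-1) (Sn A hgen a 2 n)
    = (-3:ℂ) • Sn A hgen a 4 n + (n:ℂ) • Sn A hgen a 1 (n+3)
      - (2*n:ℂ) • Sn A hgen a 2 (n+2) := by
  rw [om_neg_one_Sn hH, om_neg_two_Sn hH]
  have e : A.Y (hgen a) (-((1:ℕ):ℤ)) (A.Y (hgen a) (-(n:ℤ)) (Sn A hgen a 1 2))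
      = (2:ℂ) • A.Y (hgen a) (-((2:ℕ):ℤ)) (A.Y (hgen a) (-(n:ℤ)) (omegaV A hgen a)) := by
    rw [om_eq, map_smul, map_smul, smul_smul]
    norm_num
    have s1 : ∀ w, A.Y (hgen a) (-1) (A.Y (hgen a) (-(n:ℤ)) w)
      = A.Y (hgen a) (-(n:ℤ)) (A.Y (hgen a) (-1) w) := fun w => h_comm_neg hH a a _ _ (by omega) w
    have s2 : ∀ w, A.Y (hgen a) (-2) (A.Y (hgen a) (-(n:ℤ)) w)
      = A.Y (hgen a) (-(n:ℤ)) (A.Y (hgen a) (-2) w) := fun w => h_comm_neg hH a a _ _ (by omega) w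
    have s3 : ∀ w, A.Y (hgen a) (-2) (A.Y (hgen a) (-1) w)
      = A.Y (hgen a) (-1) (A.Y (hgen a) (-2) w) := fun w => h_comm_neg hH a a _ _ (by omega) w
    rw [s1, s2]
    simp only [Sn, Nat.cast_one, Nat.cast_ofNat]
    rw [s3, s3]
  rw [e]
  push_cast
  module

end heis
end ZhuPf


namespace ZhuPf

section heis
variable {V : Type} [AddCommGroup V] [Module ℂ V] {A : VOA V} {ℓ : ℕ} {hgen : Fin ℓ → V}

/-- Closure properties of the (image of the) subalgebra generated by the `ω_a, J_a`. -/
structure Good (A : VOA V) (hgen : Fin ℓ → V) (P : Submodule ℂ V) : Prop where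
  one : A.one ∈ P
  om : ∀ a, omegaV A hgen a ∈ P
  J : ∀ a, JV A hgen a ∈ P
  mode : ∀ (s v : V) (k n : ℕ), s ∈ A.wt k → s ∈ P → v ∈ P →
    (∀ j : ℤ, -((n+1:ℕ):ℤ) < j → A.Y s j v ∈ P) → A.Y s (-((n+1:ℕ):ℤ)) v ∈ P
  L1 : ∀ (v : V) (k : ℕ), v ∈ A.wt k → v ∈ P → A.Y A.omega 0 v ∈ P

variable {P : Submodule ℂ V}

theorem mode_IH (hH : IsHeisenberg A hgen) (hP : Good A hgen P) (d : ℤ)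
    (IH : ∀ e < d, ∀ r, Wd A hgen 0 e r ≤ P) (a : Fin ℓ) (m n : ℕ) (hm : 1 ≤ m)
    (hS : Sn A hgen a m (n+1) ∈ P) {e r : ℤ} {v : V} (hv : v ∈ Wd A hgen 0 e r) (t : ℕ)
    (hd : e + m + n + t + 1 = d) : A.Y (Sn A hgen a m (n+1)) (-((t+1:ℕ):ℤ)) v ∈ P := by
  refine hP.mode _ v (m + (n+1)) t ?_ hS (IH e (by omega) r hv) ?_
  · have := Wd_wt hH _ _ _ (Sn_mem (A := A) (hgen := hgen) a m (n+1) hm (by omega))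
    push_cast at this ⊢
    exact this
  · intro j hj
    have := Sm_mode_mem hH a m n j hv
    rw [Sm_eq] at this
    exact IH _ (by push_cast at hj; omega) _ this

theorem om_IH (hH : IsHeisenberg A hgen) (hP : Good A hgen P) (d : ℤ)
    (IH : ∀ e < d, ∀ r, Wd A hgen 0 e r ≤ P) (a : Fin ℓ)
    {e r : ℤ} {v : V} (hv : v ∈ Wd A hgen 0 e r) (t : ℕ)
    (hd : e + t + 2 = d) : A.Y (omegaV A hgen a) (-((t+1:ℕ):ℤ)) v ∈ P := by
  have h1 : Sn A hgen a 1 (0+1) ∈ P := by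
    have := P.smul_mem 2 (hP.om a)
    rw [om_eq, smul_smul] at this
    norm_num at this
    exact this
  have h := mode_IH hH hP d IH a 1 0 le_rfl h1 hv t (by push_cast; omega)
  rw [om_eq, map_smul]
  exact P.smul_mem _ h

theorem phaseB (hH : IsHeisenberg A hgen) (hP : Good A hgen P) (d : ℤ)
    (IH : ∀ e < d, ∀ r, Wd A hgen 0 e r ≤ P) (a : Fin ℓ) (m n : ℕ) (hm : 1 ≤ m) (hn : 1 ≤ n)
    (hd : (m : ℤ) + n = d) : Sn A hgen a m n ∈ P := by
  have lower : ∀ i j : ℕ, 1 ≤ i → 1 ≤ j → (i:ℤ) + j < d → Sn A hgen a i j ∈ P :=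
    fun i j hi hj h => IH _ h _ (Sn_mem a i j hi hj)
  have der : ∀ i j : ℕ, 1 ≤ i → 1 ≤ j → (i:ℤ) + j + 1 = d →
      (i:ℂ) • Sn A hgen a (i+1) j + (j:ℂ) • Sn A hgen a i (j+1) ∈ P := by
    intro i j hi hj h
    rw [← L1_Sn]
    refine hP.L1 _ (i+j) ?_ (lower i j hi hj (by omega))
    have := Wd_wt hH _ _ _ (Sn_mem (A := A) (hgen := hgen) a i j hi hj)
    push_cast
    exact this
  -- reduction to the first index being one
  have red : (∀ j : ℕ, 1 ≤ j → 1 + (j:ℤ) = d → Sn A hgen a 1 j ∈ P) → Sn A hgen a m n ∈ P := by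
    intro h1
    clear lower
    induction m generalizing n with
    | zero => omega
    | succ m ihm =>
      by_cases hm0 : m = 0
      · subst hm0; exact h1 n hn (by push_cast at hd; omega)
      · have h2 := der m n (by omega) hn (by push_cast at hd; omega)
        have h3 := ihm (n+1) (by omega) (by omega) (by push_cast at hd ⊢; omega)
        rw [Submodule.add_mem_iff_left _ (P.smul_mem _ h3), Submodule.smul_mem_iff] at h2
        · exact h2
        · exact_mod_cast hm0
  apply red
  intro j hj hjd
  have cases : j = 1 ∨ j = 2 ∨ j = 3 ∨ ∃ n : ℕ, 1 ≤ n ∧ j = n + 3 := by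
    by_cases h : j ≤ 3
    · omega
    · exact Or.inr (Or.inr (Or.inr ⟨j - 3, by omega, by omega⟩))
  rcases cases with rfl | rfl | rfl | ⟨n, hn, rfl⟩
  · have := P.smul_mem 2 (hP.om a)
    rw [om_eq, smul_smul] at this
    norm_num at this
    exact this
  · have h := der 1 1 le_rfl le_rfl (by push_cast at hjd ⊢; omega)
    rw [Sn_symm hH a (1+1) 1 (by norm_num), ← add_smul, Submodule.smul_mem_iff] at h
    · exact h
    · norm_num
  · have h1 := om_IH hH hP d IH a (Sn_mem a 1 1 le_rfl le_rfl) 0 (by push_cast at hjd ⊢; omega)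
    have h2 := der 1 2 le_rfl (by norm_num) (by push_cast at hjd ⊢; omega)
    rw [← L1_Sn] at h2
    have h3 := J_eq hH a (A := A) (hgen := hgen)
    have h4 := hP.J a
    have e : Sn A hgen a 1 3 = (9⁻¹:ℂ) • ((2:ℂ) • A.Y (omegaV A hgen a) (-1) (Sn A hgen a 1 1)
        + (3/2:ℂ) • A.Y A.omega 0 (Sn A hgen a 1 2) - JV A hgen a) := by
      rw [h3]; module
    rw [e]
    exact P.smul_mem _ (P.sub_mem (P.add_mem (P.smul_mem _ h1) (P.smul_mem _ h2)) h4)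
  · have h1 := om_IH hH hP d IH a (Sn_mem a 1 n le_rfl hn) 1 (by push_cast at hjd ⊢; omega)
    have h2 := om_IH hH hP d IH a (Sn_mem a 2 n (by norm_num) hn) 0
      (by push_cast at hjd ⊢; omega)
    have d3 := der 3 n (by norm_num) hn (by push_cast at hjd ⊢; omega)
    have d2 := der 2 (n+1) (by norm_num) (by omega) (by push_cast at hjd ⊢; omega)
    have d1 := der 1 (n+2) (by norm_num) (by omega) (by push_cast at hjd ⊢; omega)
    have h3 := high_eq hH a n (A := A) (hgen := hgen)
    simp only [Nat.reduceAdd, add_assoc] at d1 d2 d3 h1 h2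
    have h4 : A.Y (omegaV A hgen a) (-2) (Sn A hgen a 1 n)
      - (2:ℂ) • A.Y (omegaV A hgen a) (-1) (Sn A hgen a 2 n) ∈ P :=
      P.sub_mem h1 (P.smul_mem _ h2)
    rw [h3] at h4
    -- eliminate
    have e : ((n:ℂ) * ((n+1)*(n+2)/2 + 1 + 2*(n+2))) • Sn A hgen a 1 (n+3)
        = ((-3:ℂ) • Sn A hgen a 4 n + (n:ℂ) • Sn A hgen a 1 (n+3)
          - (2*n:ℂ) • Sn A hgen a 2 (n+2))
        + (1:ℂ) • (((3:ℕ):ℂ) • Sn A hgen a 4 n + (n:ℂ) • Sn A hgen a 3 (n+1))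
        - (n/2:ℂ) • (((2:ℕ):ℂ) • Sn A hgen a 3 (n+1) + ((n+1:ℕ):ℂ) • Sn A hgen a 2 (n+2))
        + (n*(n+1)/2 + 2*n:ℂ) • (((1:ℕ):ℂ) • Sn A hgen a 2 (n+2)
          + ((n+2:ℕ):ℂ) • Sn A hgen a 1 (n+3)) := by
      push_cast
      module
    have h5 : ((n:ℂ) * ((n+1)*(n+2)/2 + 1 + 2*(n+2))) • Sn A hgen a 1 (n+3) ∈ P := by
      rw [e]
      exact P.add_mem (P.sub_mem (P.add_mem h4 (P.smul_mem _ d3)) (P.smul_mem _ d2))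
        (P.smul_mem _ d1)
    rwa [Submodule.smul_mem_iff] at h5
    have : ((n:ℝ) * ((n+1)*(n+2)/2 + 1 + 2*(n+2))) ≠ 0 := by
      have : (0:ℝ) < n := by exact_mod_cast hn
      positivity
    have h2 := Complex.ofReal_ne_zero.2 this
    push_cast at h2
    exact h2

theorem phaseA (hH : IsHeisenberg A hgen) (hP : Good A hgen P) (d : ℤ)
    (IH : ∀ e < d, ∀ r, Wd A hgen 0 e r ≤ P) (N : ℕ) : ∀ L : List (Fin ℓ × ℕ+),
    L.length ≤ N → par L = 0 → (wsum L : ℤ) = d → wd A hgen L ∈ P := by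
  induction N with
  | zero =>
    intro L hL _ _
    rw [List.length_eq_zero_iff.1 (Nat.le_zero.1 hL)]
    exact hP.one
  | succ N ihN =>
    intro L hL hp hw
    cases L with
    | nil => exact hP.one
    | cons q L1 =>
      obtain ⟨a, m⟩ := q
      have ha : a ∈ L1.map Prod.fst := by
        by_contra hc
        have h1 := congrFun hp a
        rw [par_count, List.map_cons, List.count_cons, List.count_eq_zero_of_not_mem hc] at h1
        simp at h1
      obtain ⟨⟨a', n⟩, hq, rfl⟩ := List.mem_map.1 ha
      obtain ⟨s, t, rfl⟩ := List.append_of_mem hq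
      have hperm : (s ++ (a', n) :: t).Perm ((a', n) :: (s ++ t)) := List.perm_middle
      set L' := s ++ t with hL'
      have hm := m.pos
      have hn := n.pos
      have hperm2 := List.Perm.cons (a', m) hperm
      have hp' : par L' = 0 := by
        rw [par_perm hperm2] at hp
        simp only [par, single_self] at hp
        exact hp
      have hw' : (wsum L' : ℤ) + m + n = d := by
        rw [wsum_perm hperm2] at hw
        simp only [wsum_cons] at hw
        push_cast at hw
        omega
      have hlen : L'.length ≤ N - 1 ∧ 1 ≤ N := by
        have := hperm2.length_eq
        simp only [List.length_cons] at this hL ⊢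
        omega
      rw [wd_perm hH hperm2, wd_cons, wd_cons]
      obtain ⟨n', hn'⟩ : ∃ n' : ℕ, (n : ℕ) = n' + 1 := ⟨(n:ℕ) - 1, by omega⟩
      have hv := wd_mem (A := A) (hgen := hgen) L'
      rw [hp'] at hv
      have hS : Sn A hgen a' m (n'+1) ∈ P := by
        by_cases hlt : ((m:ℕ):ℤ) + ((n'+1:ℕ):ℤ) < d
        · exact IH _ hlt _ (Sn_mem a' m (n'+1) hm (by omega))
        · exact phaseB hH hP d IH a' m (n'+1) hm (by omega) (by rw [← hn']; omega)
      have h1 := mode_IH hH hP d IH a' m n' hm hS hv 0 (by push_cast; omega)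
      have h2 := Sm_mode_neg_one hH a' m n' hv
      have hle : Wd A hgen 0 (wsum L' + (m:ℕ) + n' + 1) L'.length ≤ P := by
        refine Submodule.span_le.2 ?_
        rintro v ⟨L2, q1, q2, q3, rfl⟩
        exact ihN L2 (by omega) q1 (by omega)
      have h3 := P.add_mem (hle h2) h1
      rw [Sm_eq] at h3
      rw [show (-((n:ℕ):ℤ)) = -1 - n' by omega]
      have e : (-((0+1:ℕ):ℤ)) = -1 := by norm_num
      rw [e, sub_add_cancel] at h3
      exact h3

theorem all_even (hH : IsHeisenberg A hgen) (hP : Good A hgen P) (L : List (Fin ℓ × ℕ+))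
    (hL : par L = 0) : wd A hgen L ∈ P := by
  have key : ∀ d : ℕ, ∀ L : List (Fin ℓ × ℕ+), par L = 0 → wsum L = d → wd A hgen L ∈ P := by
    intro d
    induction d using Nat.strong_induction_on with
    | _ d ih =>
      intro L hL hd
      refine phaseA hH hP d ?_ L.length L le_rfl hL (by exact_mod_cast hd)
      intro e he r
      refine Submodule.span_le.2 ?_
      rintro v ⟨L2, q1, q2, q3, rfl⟩
      exact ih (wsum L2) (by omega) L2 q1 rfl
  exact key _ L hL rfl

end heis
end ZhuPf


namespace ZhuPf

section fin
variable {V : Type} [AddCommGroup V] [Module ℂ V] {A : VOA V} {ℓ : ℕ} {hgen : Fin ℓ → V}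

theorem h_kill (hH : IsHeisenberg A hgen) (a b : Fin ℓ) (hab : a ≠ b) (x : V)
    (hx : x = omegaV A hgen a ∨ x = JV A hgen a) (j : ℤ) (hj : 0 ≤ j) :
    A.Y (hgen b) j x = 0 := by
  have h1 : ∀ (n : ℤ) (w : V), A.Y (hgen b) j (A.Y (hgen a) n w)
      = A.Y (hgen a) n (A.Y (hgen b) j w) := by
    intro n w
    rw [heis_apply hH, if_neg (fun h => hab h.1.symm), zero_smul, add_zero]
  rcases hx with rfl | rfl
  · simp only [omegaV, SV, map_smul, h1, A.create_ge _ _ hj, map_zero, smul_zero]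
  · simp only [JV, SV, map_smul, map_add, map_sub, h1, A.create_ge _ _ hj, map_zero, smul_zero,
      sub_zero, add_zero]

theorem cross_kill (hH : IsHeisenberg A hgen) (a b : Fin ℓ) (hab : a ≠ b) (x y : V)
    (hx : x = omegaV A hgen a ∨ x = JV A hgen a)
    (hy : y = omegaV A hgen b ∨ y = JV A hgen b) (i : ℤ) (hi : 0 ≤ i) :
    A.Y x i y = 0 := by
  have h1 : ∀ (n : ℤ) (w : V), A.Y x i (A.Y (hgen b) n w)
      = A.Y (hgen b) n (A.Y x i w) := by
    intro n w
    have := comm_modes A (hgen b) x w 0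
      (fun j _ => h_kill hH a b hab x hx j (by positivity)) n i
    rw [Finset.sum_range_zero, sub_eq_zero] at this
    exact this.symm
  rcases hy with rfl | rfl
  · simp only [omegaV, SV, map_smul, h1, A.create_ge _ _ hi, map_zero, smul_zero]
  · simp only [JV, SV, map_smul, map_add, map_sub, h1, A.create_ge _ _ hi, map_zero, smul_zero,
      sub_zero, add_zero]

theorem h_wt (hH : IsHeisenberg A hgen) (a : Fin ℓ) (n m : ℤ) (v : V) (hv : v ∈ A.wt m) (k : ℤ)
    (hk : k = m + n) : A.Y (hgen a) (-n) v ∈ A.wt k := by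
  have := A.mode_wt 1 _ (hH.wt_one a) m (-n) v hv
  convert this using 2
  omega

theorem om_wt (hH : IsHeisenberg A hgen) (a : Fin ℓ) : omegaV A hgen a ∈ A.wt 2 := by
  refine Submodule.smul_mem _ _ ?_
  exact h_wt hH a 1 1 _ (h_wt hH a 1 0 _ A.one_wt _ (by norm_num)) _ (by norm_num)

theorem J_wt (hH : IsHeisenberg A hgen) (a : Fin ℓ) : JV A hgen a ∈ A.wt 4 := by
  refine Submodule.add_mem _ (Submodule.sub_mem _ ?_ (Submodule.smul_mem _ _ ?_))
    (Submodule.smul_mem _ _ ?_)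
  · exact h_wt hH a 1 3 _ (h_wt hH a 1 2 _ (h_wt hH a 1 1 _
      (h_wt hH a 1 0 _ A.one_wt _ (by norm_num)) _ (by norm_num)) _ (by norm_num)) _ (by norm_num)
  · exact h_wt hH a 3 1 _ (h_wt hH a 1 0 _ A.one_wt _ (by norm_num)) _ (by norm_num)
  · exact h_wt hH a 2 2 _ (h_wt hH a 2 0 _ A.one_wt _ (by norm_num)) _ (by norm_num)

theorem omega_J (hH : IsHeisenberg A hgen) (a : Fin ℓ) (i : ℤ) (hi : 0 ≤ i) :
    A.Y (omegaV A hgen a) i (JV A hgen a) = A.Y A.omega i (JV A hgen a) := by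
  have e : A.omega = ∑ b, omegaV A hgen b := by
    rw [hH.omega_eq, Finset.smul_sum]
    rfl
  rw [e, map_sum, Finset.sum_apply, LinearMap.sum_apply, Finset.sum_eq_single a]
  · intro b _ hb
    exact cross_kill hH b a hb _ _ (Or.inl rfl) (Or.inr rfl) i hi
  · simp

variable {W : Type} [AddCommGroup W] [Module ℂ W]

theorem good_PG (S : HeisenbergPlusSetting ℓ V W)
    (ow : Fin ℓ → W) (how : ∀ a, S.ι (ow a) = omegaV S.A S.hgen a)
    (Jw : Fin ℓ → W) (hJw : ∀ a, S.ι (Jw a) = JV S.A S.hgen a) :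
    Good S.A S.hgen ((PG S.B (Set.range ow ∪ Set.range Jw)).map S.ι) := by
  have hF := S.fixedSub
  have hB : CFT S.B := cft_B (cft_A S.heis) hF
  refine ⟨⟨_, PG_one _, hF.map_one⟩, fun a => ⟨_, PG_gen hB (Or.inl ⟨a, rfl⟩), how a⟩,
    fun a => ⟨_, PG_gen hB (Or.inr ⟨a, rfl⟩), hJw a⟩, ?_, ?_⟩
  · rintro _ _ k n hk ⟨s, hs, rfl⟩ ⟨v, hv, rfl⟩ h
    refine ⟨S.B.Y s (-((n+1:ℕ):ℤ)) v, PG_mode hB k ((hF.map_wt _ _).2 hk) hs hv n ?_, hF.map_Y _ _ _⟩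
    intro j hj
    obtain ⟨z, hz, hze⟩ := h j hj
    rw [← hF.map_Y] at hze
    rw [← hF.inj hze]
    exact hz
  · rintro _ k hk ⟨v, hv, rfl⟩
    refine ⟨S.B.Y S.B.omega 0 v, ?_, by rw [hF.map_Y, hF.map_omega]⟩
    have := PG_O (Set.range ow ∪ Set.range Jw) (L1_O k v ((hF.map_wt _ _).2 hk))
    exact (Submodule.add_mem_iff_left _ (Submodule.smul_mem _ _ hv)).1 this

theorem W_mem_PG (S : HeisenbergPlusSetting ℓ V W)
    (ow : Fin ℓ → W) (how : ∀ a, S.ι (ow a) = omegaV S.A S.hgen a)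
    (Jw : Fin ℓ → W) (hJw : ∀ a, S.ι (Jw a) = JV S.A S.hgen a) (x : W)
    (hx : S.ι x ∈ wordSpanV S.A S.hgen (∅ : Finset (Fin ℓ))) :
    x ∈ PG S.B (Set.range ow ∪ Set.range Jw) := by
  have h : wordSpanV S.A S.hgen (∅ : Finset (Fin ℓ))
      ≤ (PG S.B (Set.range ow ∪ Set.range Jw)).map S.ι := by
    refine Submodule.span_le.2 ?_
    rintro _ ⟨L, hL, rfl⟩
    refine all_even S.heis (good_PG S ow how Jw hJw) L ?_
    funext c
    rw [par_count, Pi.zero_apply, ZMod.natCast_eq_zero_iff_even]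
    have := hL c
    simpa using this
  obtain ⟨z, hz, hze⟩ := h hx
  rw [← S.fixedSub.inj hze]
  exact hz

theorem gens_comm (S : HeisenbergPlusSetting ℓ V W)
    (ow : Fin ℓ → W) (how : ∀ a, S.ι (ow a) = omegaV S.A S.hgen a)
    (Jw : Fin ℓ → W) (hJw : ∀ a, S.ι (Jw a) = JV S.A S.hgen a) :
    ∀ g ∈ Set.range ow ∪ Set.range Jw, ∀ g' ∈ Set.range ow ∪ Set.range Jw,
      Lm S.B g g' - Lm S.B g' g ∈ S.B.Osub := by
  have hF := S.fixedSub
  have hB : CFT S.B := cft_B (cft_A S.heis) hF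
  have ho : ∀ a, ow a ∈ S.B.wt 2 := fun a => (hF.map_wt _ _).2 (by rw [how]; exact om_wt S.heis a)
  have hJ : ∀ a, Jw a ∈ S.B.wt 4 := fun a => (hF.map_wt _ _).2 (by rw [hJw]; exact J_wt S.heis a)
  have key : ∀ a, Lm S.B (ow a) (Jw a) - Lm S.B (Jw a) (ow a) ∈ S.B.Osub := by
    intro a
    have h1 := comm_O hB 1 (ow a) (Jw a) (by simpa using ho a)
    have hm : ∀ i : ℤ, 0 ≤ i → S.B.Y (ow a) i (Jw a) = S.B.Y S.B.omega i (Jw a) := by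
      intro i hi
      apply hF.inj
      rw [hF.map_Y, hF.map_Y, hF.map_omega, how, hJw]
      exact omega_J S.heis a i hi
    obtain ⟨N, hN⟩ := exists_bound S.B (ow a) (Jw a)
    have h2 : Dm S.B 1 (ow a) (Jw a) ∈ S.B.Osub := by
      rw [Dm_sum 1 _ _ (2 + N) (fun i hi => hN i (by omega)), Finset.sum_range_add,
        Finset.sum_eq_zero (s := Finset.range N), Finset.sum_range_succ, Finset.sum_range_one,
        hm _ (by norm_num), hm _ (by norm_num)]
      · have h3 := L1_O 4 (Jw a) (hJ a)
        have h4 := S.B.L0_diag 4 _ (hJ a)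
        simpa [h4] using h3
      · intro i _
        rw [Nat.choose_eq_zero_of_lt (by omega)]
        simp
    simpa using S.B.Osub.add_mem h1 h2
  have cross : ∀ a b, a ≠ b → ∀ x y, (x = ow a ∨ x = Jw a) → (y = ow b ∨ y = Jw b) →
      Lm S.B x y - Lm S.B y x ∈ S.B.Osub := by
    intro a b hab x y hx hy
    have hk : ∃ k : ℕ, x ∈ S.B.wt ((k+1:ℕ):ℤ) := by
      rcases hx with rfl | rfl
      · exact ⟨1, by simpa using ho a⟩
      · exact ⟨3, by simpa using hJ a⟩
    obtain ⟨k, hk⟩ := hk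
    have h1 := comm_O hB k x y hk
    have h2 : Dm S.B k x y = 0 := by
      rw [Dm_sum k x y 0, Finset.sum_range_zero]
      intro i _
      apply hF.inj
      rw [hF.map_Y, map_zero]
      refine cross_kill S.heis a b hab _ _ ?_ ?_ _ (by positivity)
      · rw [← how, ← hJw]
        exact hx.imp (congrArg _) (congrArg _)
      · rw [← how, ← hJw]
        exact hy.imp (congrArg _) (congrArg _)
    rwa [h2, sub_zero] at h1
  have main : ∀ a b x y, (x = ow a ∨ x = Jw a) → (y = ow b ∨ y = Jw b) →
      Lm S.B x y - Lm S.B y x ∈ S.B.Osub := by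
    intro a b x y hx hy
    by_cases hab : a = b
    · subst hab
      rcases hx with rfl | rfl <;> rcases hy with rfl | rfl
      · rw [sub_self]; exact zero_mem _
      · exact key a
      · rw [← neg_sub]; exact neg_mem (key a)
      · rw [sub_self]; exact zero_mem _
    · exact cross a b hab x y hx hy
  have un : ∀ g ∈ Set.range ow ∪ Set.range Jw, ∃ a, g = ow a ∨ g = Jw a := by
    rintro g (⟨a, rfl⟩ | ⟨a, rfl⟩)
    · exact ⟨a, Or.inl rfl⟩
    · exact ⟨a, Or.inr rfl⟩
  intro g hg g' hg'
  obtain ⟨a, ha⟩ := un g hg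
  obtain ⟨b, hb⟩ := un g' hg'
  exact main a b g g' ha hb

end fin

end ZhuPf

/-- Corollary 4.1.2. Let `𝓦 = 𝓗₁⁺ ⊗ ⋯ ⊗ 𝓗_ℓ⁺ ⊆ 𝓗⁺` (the span
of the monomials with an even number of letters from every `𝓗_a`) and let
`A[𝓦]` be its image in `A(𝓗⁺)`. Then `A[𝓦]` is generated as an algebra by the
elements `[ω_a]`, `[J_a]`, `a = 1,…,ℓ`; in particular it is a commutative
subalgebra of `A(𝓗⁺)`. -/
theorem statement7 (ℓ : ℕ) {V W : Type} [AddCommGroup V] [Module ℂ V]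
    [AddCommGroup W] [Module ℂ W] (S : HeisenbergPlusSetting ℓ V W)
    (ow : Fin ℓ → W) (how : ∀ a, S.ι (ow a) = omegaV S.A S.hgen a)
    (Jw : Fin ℓ → W) (hJw : ∀ a, S.ι (Jw a) = JV S.A S.hgen a) :
    (∀ x : W, S.ι x ∈ wordSpanV S.A S.hgen (∅ : Finset (Fin ℓ)) →
      ∃ y ∈ genMonomials S.B (Set.range ow ∪ Set.range Jw), x - y ∈ S.B.Osub) ∧
    (∀ x y : W, S.ι x ∈ wordSpanV S.A S.hgen (∅ : Finset (Fin ℓ)) →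
      S.ι y ∈ wordSpanV S.A S.hgen (∅ : Finset (Fin ℓ)) →
      S.B.star x y - S.B.star y x ∈ S.B.Osub) := by
  have hB : ZhuPf.CFT S.B := ZhuPf.cft_B (ZhuPf.cft_A S.heis) S.fixedSub
  refine ⟨fun x hx => ?_, fun x y hx hy => ?_⟩
  · obtain ⟨y, hy, o, ho, h⟩ := Submodule.mem_sup.1 (ZhuPf.W_mem_PG S ow how Jw hJw x hx)
    refine ⟨y, hy, ?_⟩
    rw [← h, add_sub_cancel_left]
    exact ho
  · rw [ZhuPf.star_eq hB, ZhuPf.star_eq hB]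
    exact ZhuPf.PG_comm hB (ZhuPf.gens_comm S ow how Jw hJw)
      (ZhuPf.W_mem_PG S ow how Jw hJw x hx) (ZhuPf.W_mem_PG S ow how Jw hJw y hy)
end
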